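/- (Lemma 2.7, abstract form: Łojasiewicz inequality along an analytic parametrization.) Let V be a real Hilbert space, n ≥ 1, ψ : ℝⁿ → V analytic in a neighborhood of 0, and E : V → ℝ analytic in a neighborhood of ψ(0) with ∇E(ψ(0)) = 0. Then there exist θ ∈ (0, 1/2], C > 0 and r > 0 such that |E(ψ(x)) − E(ψ(0))|^{1−θ} ≤ C‖∇E(ψ(x))‖ for every x ∈ ℝⁿ with ‖x‖ < r. -/

import Mathlib

open Set

section Helpers

open Filter Topology

namespace AnalyticDivision

variable {E : Type*} [NormedAddCommGroup E] [NormedSpace ℝ E]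

/-- The projection along `e` onto the kernel of `L` (when `L e = 1`). -/
noncomputable def proj (L : E →L[ℝ] ℝ) (e : E) : E →L[ℝ] E :=
  ContinuousLinearMap.id ℝ E - L.smulRight e

lemma proj_apply (L : E →L[ℝ] ℝ) (e v : E) : proj L e v = v - L v • e := by
  simp [proj]

/-- The slots filled by the argument itself (before `j`) or its projection (after `j`). -/
noncomputable def slots (L : E →L[ℝ] ℝ) (e : E) {k : ℕ} (j : Fin (k + 1)) :
    Fin (k + 1) → (E →L[ℝ] E) :=
  fun i => if i ≤ j then ContinuousLinearMap.id ℝ E else proj L e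

/-- The power series of the quotient of `f v - f (v - L v • e)` by `L v`. -/
noncomputable def quotSeries (L : E →L[ℝ] ℝ) (e : E) (p : FormalMultilinearSeries ℝ E ℝ) :
    FormalMultilinearSeries ℝ E ℝ := fun k =>
  ∑ j : Fin (k + 1), ((p (k + 1)).compContinuousLinearMap (slots L e j)).curryMid j e

lemma telescope (L : E →L[ℝ] ℝ) (e : E) (p : FormalMultilinearSeries ℝ E ℝ) (k : ℕ) (v : E) :
    p (k + 1) (fun _ => v) - p (k + 1) (fun _ => v - L v • e)
      = L v * quotSeries L e p k (fun _ => v) := by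
  set a : ℕ → ℝ := fun j => p (k + 1) (fun i => if (i : ℕ) < j then v else v - L v • e) with ha
  have h1 : p (k + 1) (fun _ => v) = a (k + 1) := by
    simp only [ha]; congr 1; ext i; simp [i.2]
  have h0 : p (k + 1) (fun _ => v - L v • e) = a 0 := by simp [ha]
  rw [h1, h0, ← Finset.sum_range_sub, ← Fin.sum_univ_eq_sum_range
    (fun j => a (j + 1) - a j) (k + 1)]
  simp only [quotSeries, sum_apply, Finset.mul_sum]
  refine Finset.sum_congr rfl fun j _ => ?_
  rw [ContinuousMultilinearMap.curryMid_apply,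
    ContinuousMultilinearMap.compContinuousLinearMap_apply]
  set w : Fin (k + 1) → E := fun i => if (i : ℕ) < j then v else v - L v • e with hw
  have e1 : a (j + 1) = p (k + 1) (Function.update w j v) := by
    simp only [ha]; congr 1; ext i
    by_cases hij : i = j
    · subst hij; simp
    · rw [Function.update_of_ne hij, hw]
      have : (i : ℕ) ≠ j := fun h => hij (Fin.ext h)
      simp only [show ((i : ℕ) < (j : ℕ) + 1) ↔ (i : ℕ) < j by omega]
  have e0 : a j = p (k + 1) (Function.update w j (v - L v • e)) := by
    simp only [ha]; congr 1; ext i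
    by_cases hij : i = j
    · subst hij; simp
    · rw [Function.update_of_ne hij]
  rw [e1, e0, ← ContinuousMultilinearMap.map_update_sub, sub_sub_cancel,
    ContinuousMultilinearMap.map_update_smul, smul_eq_mul]
  congr 2
  ext i
  by_cases hij : i = j
  · subst hij; simp [slots]
  · rw [Function.update_of_ne hij]
    obtain ⟨l, rfl⟩ := Fin.exists_succAbove_eq hij
    simp only [slots, Fin.insertNth_apply_succAbove, hw]
    have : ((j.succAbove l : Fin (k+1)) : ℕ) ≠ j := fun h => hij (Fin.ext h)
    by_cases h : ((j.succAbove l : Fin (k+1)) : ℕ) < j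
    · rw [if_pos h, if_pos (Fin.le_def.2 h.le)]; rfl
    · rw [if_neg h, if_neg (fun h' => h (lt_of_le_of_ne (Fin.le_def.1 h') this)), proj_apply]

lemma radius_quotSeries_pos (L : E →L[ℝ] ℝ) (e : E) (p : FormalMultilinearSeries ℝ E ℝ)
    (hp : 0 < p.radius) : 0 < (quotSeries L e p).radius := by
  obtain ⟨C, r, hC, hr, hpn⟩ := p.le_mul_pow_of_radius_pos hp
  set M : ℝ := max 1 ‖proj L e‖
  have hM1 : 1 ≤ M := le_max_left _ _
  have hM0 : 0 < M := lt_of_lt_of_le one_pos hM1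
  have hslot : ∀ k (j i : Fin (k + 1)), ‖slots L e j i‖ ≤ M := by
    intro k j i
    unfold slots
    split_ifs
    · exact ContinuousLinearMap.norm_id_le.trans hM1
    · exact le_max_right _ _
  have key : ∀ k, ‖quotSeries L e p k‖ ≤ (C * ‖e‖ * (2 * r * M)) * (2 * r * M) ^ k := by
    intro k
    have h1 : ∀ j : Fin (k + 1),
        ‖((p (k + 1)).compContinuousLinearMap (slots L e j)).curryMid j e‖
          ≤ C * r ^ (k + 1) * M ^ (k + 1) * ‖e‖ := by
      intro j
      refine (ContinuousLinearMap.le_opNorm _ _).trans ?_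
      refine mul_le_mul_of_nonneg_right ?_ (norm_nonneg _)
      rw [ContinuousMultilinearMap.norm_curryMid]
      refine (ContinuousMultilinearMap.norm_compContinuousLinearMap_le _ _).trans ?_
      refine mul_le_mul (hpn _) ?_ (Finset.prod_nonneg fun _ _ => norm_nonneg _) (by positivity)
      refine (Finset.prod_le_prod (fun _ _ => norm_nonneg _) (fun i _ => hslot k j i)).trans ?_
      simp
    have h2 : ((k : ℝ) + 1) ≤ 2 ^ (k + 1) := by
      exact_mod_cast (Nat.lt_two_pow_self (n := k + 1)).le
    calc ‖quotSeries L e p k‖ ≤ ∑ j : Fin (k + 1), C * r ^ (k + 1) * M ^ (k + 1) * ‖e‖ :=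
          norm_sum_le_of_le _ fun j _ => h1 j
      _ = ((k : ℝ) + 1) * (C * r ^ (k + 1) * M ^ (k + 1) * ‖e‖) := by simp
      _ ≤ 2 ^ (k + 1) * (C * r ^ (k + 1) * M ^ (k + 1) * ‖e‖) := by gcongr
      _ = _ := by ring
  have hR : 0 < 2 * r * M := by positivity
  have : ((Real.toNNReal (2 * r * M)⁻¹ : NNReal) : ENNReal) ≤ (quotSeries L e p).radius := by
    refine FormalMultilinearSeries.le_radius_of_bound _ (C * ‖e‖ * (2 * r * M)) fun k => ?_
    rw [Real.coe_toNNReal _ (by positivity)]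
    calc _ ≤ (C * ‖e‖ * (2 * r * M)) * (2 * r * M) ^ k * ((2 * r * M)⁻¹) ^ k := by
          gcongr; exact key k
      _ = _ := by rw [mul_assoc, ← mul_pow, mul_inv_cancel₀ hR.ne', one_pow, mul_one]
  refine lt_of_lt_of_le ?_ this
  exact ENNReal.coe_pos.2 (Real.toNNReal_pos.2 (inv_pos.2 hR))

/-- Hadamard's lemma for analytic functions: `f v - f (v - L v • e)` is divisible by the linear
form `L`, with analytic quotient. -/
theorem _root_.AnalyticAt.exists_eq_add_mul (L : E →L[ℝ] ℝ) (e : E) {f : E → ℝ}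
    (hf : AnalyticAt ℝ f 0) :
    ∃ h : E → ℝ, AnalyticAt ℝ h 0 ∧ ∀ᶠ v in 𝓝 0, f v = f (v - L v • e) + L v * h v := by
  obtain ⟨p, hp⟩ := hf
  have hq := radius_quotSeries_pos L e p hp.radius_pos
  have hQ := (quotSeries L e p).hasFPowerSeriesOnBall hq
  refine ⟨(quotSeries L e p).sum, hQ.analyticAt, ?_⟩
  have hP : Tendsto (fun v : E => v - L v • e) (𝓝 0) (𝓝 0) := by
    have : Continuous fun v : E => v - L v • e := by fun_prop
    simpa using this.tendsto 0
  filter_upwards [hp.eventually_hasSum, hP.eventually hp.eventually_hasSum,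
    hQ.hasFPowerSeriesAt.eventually_hasSum] with v h1 h2 h3
  simp only [zero_add] at h1 h2 h3
  have h4 := h1.sub h2
  rw [← hasSum_nat_add_iff' 1] at h4
  simp only [telescope] at h4
  have h5 := h4.unique (h3.mul_left (L v))
  have h6 : p 0 (fun _ => v) = p 0 (fun _ => v - L v • e) := by
    congr 1; ext i; exact i.elim0
  simp only [Finset.range_one, Finset.sum_singleton, h6, sub_self, sub_zero] at h5
  linarith

end AnalyticDivision

section Taylor

variable {E : Type*} [NormedAddCommGroup E] [NormedSpace ℝ E]

/-- Partial Taylor expansion of an analytic function in its last variable. -/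
theorem AnalyticAt.exists_taylor_snd {f : E × ℝ → ℝ} (hf : AnalyticAt ℝ f 0) (d : ℕ) :
    ∃ (c : ℕ → E → ℝ) (u : E × ℝ → ℝ), (∀ i, AnalyticAt ℝ (c i) 0) ∧ AnalyticAt ℝ u 0 ∧
      ∀ᶠ p in 𝓝 (0 : E × ℝ), f p = ∑ i ∈ Finset.range d, c i p.1 * p.2 ^ i + p.2 ^ d * u p := by
  induction d with
  | zero => exact ⟨0, f, fun i => analyticAt_const, hf, by simp⟩
  | succ d ih =>
    obtain ⟨c, u, hc, hu, h⟩ := ih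
    obtain ⟨w, hw, hw'⟩ := hu.exists_eq_add_mul (ContinuousLinearMap.snd ℝ E ℝ) (0, 1)
    have hcd : AnalyticAt ℝ (fun y : E => u (y, 0)) 0 :=
      hu.comp_of_eq (f := fun y : E => (y, (0 : ℝ))) (by fun_prop) rfl
    refine ⟨Function.update c d fun y => u (y, 0), w, fun i => ?_, hw, ?_⟩
    · by_cases hi : i = d
      · subst hi; simpa using hcd
      · simpa [hi] using hc i
    · filter_upwards [h, hw'] with p h1 h2
      have h3 : p - (ContinuousLinearMap.snd ℝ E ℝ) p • ((0, 1) : E × ℝ) = (p.1, 0) := by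
        ext <;> simp
      rw [h3] at h2
      rw [h1, Finset.sum_range_succ]
      have : ∀ i ∈ Finset.range d, Function.update c d (fun y => u (y, 0)) i p.1 * p.2 ^ i
          = c i p.1 * p.2 ^ i := fun i hi => by
        rw [Function.update_of_ne (Finset.mem_range.1 hi).ne]
      rw [Finset.sum_congr rfl this, h2]
      simp
      ring

/-- Uniqueness of Taylor coefficients. -/
theorem taylor_coeff_eq_zero (d : ℕ) (a : ℕ → ℝ) (w : ℝ → ℝ) (hw : ContinuousAt w 0)
    (h : ∀ᶠ z in 𝓝 (0 : ℝ), ∑ i ∈ Finset.range d, a i * z ^ i + z ^ d * w z = 0) :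
    (∀ i < d, a i = 0) ∧ w 0 = 0 := by
  induction d generalizing a with
  | zero => exact ⟨by simp, by simpa using h.self_of_nhds⟩
  | succ d ih =>
    have h0 : a 0 = 0 := by
      have := h.self_of_nhds
      simpa [Finset.sum_range_succ'] using this
    set g : ℝ → ℝ := fun z => ∑ i ∈ Finset.range d, a (i + 1) * z ^ i + z ^ d * w z with hg
    have hgc : ContinuousAt g 0 := by simp only [hg]; fun_prop
    have hne : ∀ᶠ z in 𝓝[≠] (0 : ℝ), g z = 0 := by
      filter_upwards [h.filter_mono nhdsWithin_le_nhds, self_mem_nhdsWithin] with z hz hz0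
      have hz0 : z ≠ 0 := hz0
      have : z * g z = 0 := by
        rw [← hz, Finset.sum_range_succ', h0]
        simp only [hg, mul_add, Finset.mul_sum]
        congr 1
        · simp only [zero_mul, add_zero]
          exact Finset.sum_congr rfl fun i _ => by ring
        · ring
      exact (mul_eq_zero.1 this).resolve_left hz0
    have hg0 : g 0 = 0 :=
      tendsto_nhds_unique (hgc.tendsto.mono_left nhdsWithin_le_nhds)
        ((tendsto_congr' hne).2 tendsto_const_nhds)
    have hall : ∀ᶠ z in 𝓝 (0 : ℝ), g z = 0 := by
      rw [eventually_nhdsWithin_iff] at hne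
      filter_upwards [hne] with z hz
      by_cases hz0 : z = 0
      · rw [hz0, hg0]
      · exact hz hz0
    obtain ⟨h1, h2⟩ := ih (fun i => a (i + 1)) hall
    refine ⟨fun i hi => ?_, h2⟩
    cases i with
    | zero => exact h0
    | succ i => exact h1 i (by omega)

/-- The analytic implicit function theorem for a scalar equation in a scalar unknown. -/
theorem AnalyticAt.exists_implicit [CompleteSpace E] {g : E × ℝ → ℝ} (hg : AnalyticAt ℝ g 0)
    (h0 : g 0 = 0) (h1 : fderiv ℝ g 0 (0, 1) ≠ 0) :
    ∃ φ : E → ℝ, AnalyticAt ℝ φ 0 ∧ φ 0 = 0 ∧ ∀ᶠ y in 𝓝 0, g (y, φ y) = 0 := by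
  have cd : ContDiffAt ℝ ⊤ g 0 := hg.contDiffAt
  have inv : (fderiv ℝ g 0 ∘L .inr ℝ E ℝ).IsInvertible := by
    refine ⟨ContinuousLinearEquiv.unitsEquivAut ℝ (Units.mk0 _ h1), ?_⟩
    ext
    simp
  have hn : (⊤ : WithTop ℕ∞) ≠ 0 := by simp
  refine ⟨cd.implicitFunction hn inv, ?_, ?_, ?_⟩
  · exact (cd.contDiffAt_implicitFunction hn inv).analyticAt
  · exact cd.implicitFunction_apply_self hn inv
  · filter_upwards [cd.eventually_apply_implicitFunction hn inv] with y hy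
    rw [hy, h0]

/-- Tschirnhaus transformation: after an analytic translation of the last variable, an analytic
function of order `m + 1` in that variable has no term of degree `m` in it. -/
theorem AnalyticAt.exists_tschirnhaus [CompleteSpace E] {f : E × ℝ → ℝ} (hf : AnalyticAt ℝ f 0)
    (m : ℕ) {v : ℝ → ℝ} (hv : AnalyticAt ℝ v 0) (hv0 : v 0 ≠ 0)
    (hfv : ∀ᶠ z in 𝓝 (0 : ℝ), f (0, z) = z ^ (m + 1) * v z) :
    ∃ (φ : E → ℝ) (c : ℕ → E → ℝ) (u : E × ℝ → ℝ), AnalyticAt ℝ φ 0 ∧ φ 0 = 0 ∧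
      (∀ i, AnalyticAt ℝ (c i) 0) ∧ (∀ i < m, c i 0 = 0) ∧ AnalyticAt ℝ u 0 ∧ u 0 ≠ 0 ∧
      ∀ᶠ p in 𝓝 (0 : E × ℝ), f (p.1, p.2 + φ p.1) =
        ∑ i ∈ Finset.range m, c i p.1 * p.2 ^ i + p.2 ^ (m + 1) * u p := by
  have hF : AnalyticAt ℝ (fun q : (E × ℝ) × ℝ => f (q.1.1, q.1.2 + q.2)) 0 :=
    hf.comp_of_eq (f := fun q : (E × ℝ) × ℝ => (q.1.1, q.1.2 + q.2))
      ((analyticAt_fst.comp_of_eq analyticAt_fst rfl).prod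
        ((analyticAt_snd.comp_of_eq analyticAt_fst rfl).add analyticAt_snd)) (by simp)
  obtain ⟨C, U, hC, hU, hFe⟩ := hF.exists_taylor_snd (m + 1)
  -- values at the origin
  have hline : Tendsto (fun z : ℝ => (((0 : E), (0 : ℝ)), z)) (𝓝 0) (𝓝 0) := by
    have : Continuous (fun z : ℝ => (((0 : E), (0 : ℝ)), z)) := by fun_prop
    exact this.tendsto 0
  have hUline : AnalyticAt ℝ (fun z : ℝ => U ((0, 0), z)) 0 :=
    hU.comp_of_eq (f := fun z : ℝ => (((0 : E), (0 : ℝ)), z)) (by fun_prop) rfl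
  obtain ⟨hC0, hU0⟩ := taylor_coeff_eq_zero (m + 1) (fun i => C i 0)
    (fun z => U ((0, 0), z) - v z) (hUline.continuousAt.sub hv.continuousAt) (by
      filter_upwards [hline.eventually hFe, hfv] with z h1 h2
      simp only [zero_add] at h1
      rw [h2] at h1
      have : ∑ i ∈ Finset.range (m + 1), C i 0 * z ^ i
        = ∑ i ∈ Finset.range (m + 1), C i (0, 0) * z ^ i := rfl
      rw [this]
      linarith)
  -- derivative of the coefficient of degree `m`
  have hplane : Tendsto (fun q : ℝ × ℝ => (((0 : E), q.2), q.1)) (𝓝 (0, 0)) (𝓝 0) := by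
    have : Continuous (fun q : ℝ × ℝ => (((0 : E), q.2), q.1)) := by fun_prop
    exact this.tendsto (0, 0)
  have hsum : Tendsto (fun q : ℝ × ℝ => q.2 + q.1) (𝓝 (0, 0)) (𝓝 0) := by
    have : Continuous (fun q : ℝ × ℝ => q.2 + q.1) := by fun_prop
    simpa using this.tendsto (0, 0)
  have h2 := (hplane.eventually hFe).and (hsum.eventually hfv)
  rw [nhds_prod_eq] at h2
  have h3 := h2.curry
  have hder : ∀ᶠ z in 𝓝 (0 : ℝ),
      ((m : ℝ) + 1) * z ^ m * v z + z ^ (m + 1) * deriv v z =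
      ∑ i ∈ Finset.range (m + 1), fderiv ℝ (C i) 0 (0, 1) * z ^ i
        + z ^ (m + 1) * fderiv ℝ U ((0, 0), z) ((0, 1), 0) := by
    filter_upwards [h3, hv.eventually_analyticAt, hline.eventually hU.eventually_analyticAt]
      with z hz hvz hUz
    have eq : (fun s : ℝ => (s + z) ^ (m + 1) * v (s + z)) =ᶠ[𝓝 0] fun s =>
        ∑ i ∈ Finset.range (m + 1), C i (0, s) * z ^ i + z ^ (m + 1) * U ((0, s), z) := by
      filter_upwards [hz] with s hs
      rw [← hs.2, ← hs.1]
    have d0 : HasDerivAt (fun s : ℝ => s + z) 1 0 := (hasDerivAt_id _).add_const _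
    have d1 : HasDerivAt (fun s : ℝ => (s + z) ^ (m + 1) * v (s + z))
        (((m : ℝ) + 1) * z ^ m * v z + z ^ (m + 1) * deriv v z) 0 := by
      have hd : HasDerivAt v (deriv v z) (0 + z) := by
        rw [zero_add]; exact hvz.differentiableAt.hasDerivAt
      exact ((d0.pow (m + 1)).mul (hd.comp 0 d0)).congr_deriv (by simp)
    have dl : HasDerivAt (fun s : ℝ => ((0 : E), s)) (0, 1) 0 :=
      (hasDerivAt_const _ _).prodMk (hasDerivAt_id _)
    have dC : ∀ i, HasDerivAt (fun s : ℝ => C i (0, s)) (fderiv ℝ (C i) 0 (0, 1)) 0 := fun i =>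
      HasFDerivAt.comp_hasDerivAt (f := fun s : ℝ => ((0 : E), s)) 0
        (hC i).differentiableAt.hasFDerivAt dl
    have dU : HasDerivAt (fun s : ℝ => U ((0, s), z)) (fderiv ℝ U ((0, 0), z) ((0, 1), 0)) 0 :=
      HasFDerivAt.comp_hasDerivAt (f := fun s : ℝ => (((0 : E), s), z)) 0
        hUz.differentiableAt.hasFDerivAt (dl.prodMk (hasDerivAt_const _ _))
    have d2 := (HasDerivAt.fun_sum (u := Finset.range (m + 1))
      fun i _ => (dC i).mul_const (z ^ i)).add (dU.const_mul (z ^ (m + 1)))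
    exact d1.unique (d2.congr_of_eventuallyEq eq)
  have hUder : ContinuousAt (fun z : ℝ => fderiv ℝ U ((0, 0), z) ((0, 1), 0)) 0 := by
    have h := (hU.fderiv.comp_of_eq (f := fun z : ℝ => (((0 : E), (0 : ℝ)), z)) (x := 0)
      (by fun_prop) rfl).continuousAt
    exact h.clm_apply continuousAt_const
  obtain ⟨-, hCm⟩ := taylor_coeff_eq_zero m (fun i => fderiv ℝ (C i) 0 (0, 1))
    (fun z => fderiv ℝ (C m) 0 (0, 1) + z * (fderiv ℝ U ((0, 0), z) ((0, 1), 0) - deriv v z)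
      - ((m : ℝ) + 1) * v z)
    (((continuousAt_const.add (continuousAt_id.mul (hUder.sub hv.deriv.continuousAt)))).sub
      (continuousAt_const.mul hv.continuousAt)) (by
      filter_upwards [hder] with z hz
      rw [Finset.sum_range_succ] at hz
      linear_combination -hz)
  have hCm' : fderiv ℝ (C m) 0 (0, 1) ≠ 0 := by
    have : fderiv ℝ (C m) 0 (0, 1) = ((m : ℝ) + 1) * v 0 := by linear_combination hCm
    rw [this]
    exact mul_ne_zero (by positivity) hv0
  obtain ⟨φ, hφ, hφ0, hφe⟩ := (hC m).exists_implicit (hC0 m (by omega)) hCm'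
  have hgraph : AnalyticAt ℝ (fun y : E => (y, φ y)) 0 := analyticAt_id.prod hφ
  have hgraph0 : ((0 : E), φ 0) = 0 := by rw [hφ0]; rfl
  have hG : AnalyticAt ℝ (fun p : E × ℝ => ((p.1, φ p.1), p.2)) 0 :=
    (analyticAt_fst.prod (hφ.comp_of_eq analyticAt_fst rfl)).prod analyticAt_snd
  have hG0 : (fun p : E × ℝ => ((p.1, φ p.1), p.2)) 0 = 0 := by simp [hφ0]
  refine ⟨φ, fun i y => C i (y, φ y), fun p => U ((p.1, φ p.1), p.2), hφ, hφ0,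
    fun i => (hC i).comp_of_eq hgraph hgraph0, fun i hi => ?_, hU.comp_of_eq hG hG0, ?_, ?_⟩
  · change C i (0, φ 0) = 0
    rw [hgraph0]
    exact hC0 i (by omega)
  · have : U ((0, 0), 0) = v 0 := by linear_combination hU0
    change U ((0, φ 0), 0) ≠ 0
    rw [hφ0, this]
    exact hv0
  · have hGt : Tendsto (fun p : E × ℝ => ((p.1, φ p.1), p.2)) (𝓝 0) (𝓝 0) :=
      hG.continuousAt.tendsto.mono_right (congrArg 𝓝 hG0).le
    filter_upwards [hGt.eventually hFe,
      (continuous_fst.tendsto (0 : E × ℝ)).eventually hφe] with p h1 h2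
    rw [add_comm, h1, Finset.sum_range_succ, h2]
    ring

end Taylor

section Toric

variable {X : Type*}

lemma Ultrafilter.exists_eq_mul_abs (U : Ultrafilter X) (g : X → ℝ) :
    ∃ ε : ℝ, ε ≠ 0 ∧ ∀ᶠ a in (U : Filter X), g a = ε * |g a| := by
  rcases U.em (fun a => 0 ≤ g a) with h | h
  · exact ⟨1, one_ne_zero, h.mono fun a ha => by rw [abs_of_nonneg ha, one_mul]⟩
  · exact ⟨-1, by norm_num, h.mono fun a ha => by
      rw [abs_of_neg (not_le.1 ha)]; ring⟩

lemma Ultrafilter.exists_tendsto_of_abs_le (U : Ultrafilter X) {g : X → ℝ} {C : ℝ}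
    (h : ∀ᶠ a in (U : Filter X), |g a| ≤ C) : ∃ t, Tendsto g U (𝓝 t) := by
  have := (isCompact_Icc (a := -C) (b := C)).ultrafilter_le_nhds' (U.map g)
    (h.mono fun a ha => abs_le.1 ha)
  obtain ⟨t, -, ht⟩ := this
  exact ⟨t, ht⟩

lemma tendsto_abs_rpow_inv {l : Filter X} {g : X → ℝ} (hg : Tendsto g l (𝓝 0)) {a : ℕ}
    (ha : a ≠ 0) : Tendsto (fun z => |g z| ^ (a : ℝ)⁻¹) l (𝓝 0) := by
  have := (hg.abs).rpow_const (p := (a : ℝ)⁻¹) (Or.inr (by positivity))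
  rwa [abs_zero, Real.zero_rpow (by positivity)] at this

variable {ι : Type*} [Fintype ι]

/-- The germ of `f` at `0` is the monomial of exponent `α` times an analytic unit. -/
def IsNormalCrossing (f : (ι → ℝ) → ℝ) (α : ι → ℕ) : Prop :=
  ∃ u : (ι → ℝ) → ℝ, AnalyticAt ℝ u 0 ∧ u 0 ≠ 0 ∧
    f =ᶠ[𝓝 0] fun y => (∏ i, y i ^ α i) * u y

/-- Along the ultrafilter `U`, the points `x` are the images of points `y` tending to `0` under an
analytic germ `π` of maps fixing the origin. -/
structure AnalyticChart (U : Ultrafilter X) (x y : X → ι → ℝ) (π : (ι → ℝ) → ι → ℝ) : Prop where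
  tendsto : Tendsto y U (𝓝 0)
  analyticAt : AnalyticAt ℝ π 0
  map_zero : π 0 = 0
  eventuallyEq : ∀ᶠ a in (U : Filter X), x a = π (y a)

/-- A chart whose components are monomials times units, with exponents the rows of `A`. -/
structure MonomialChart (U : Ultrafilter X) (x y : X → ι → ℝ) (π : (ι → ℝ) → ι → ℝ)
    (A : Matrix ι ι ℕ) : Prop extends AnalyticChart U x y π where
  isNormalCrossing : ∀ i, IsNormalCrossing (fun w => π w i) (A i)

lemma IsNormalCrossing.congr {f g : (ι → ℝ) → ℝ} {α : ι → ℕ} (h : IsNormalCrossing f α)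
    (hfg : g =ᶠ[𝓝 0] f) : IsNormalCrossing g α := by
  obtain ⟨u, hu, hu0, he⟩ := h
  exact ⟨u, hu, hu0, hfg.trans he⟩

lemma AnalyticChart.tendsto_map {U : Ultrafilter X} {x y : X → ι → ℝ} {π : (ι → ℝ) → ι → ℝ}
    (h : AnalyticChart U x y π) : Tendsto π (𝓝 0) (𝓝 0) := by
  simpa [h.map_zero] using h.analyticAt.continuousAt.tendsto

lemma AnalyticChart.refl {U : Ultrafilter X} {x : X → ι → ℝ} (hx : Tendsto x U (𝓝 0)) :
    AnalyticChart U x x id :=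
  ⟨hx, analyticAt_id, rfl, by simp⟩

lemma AnalyticChart.trans {U : Ultrafilter X} {x y z : X → ι → ℝ} {π ρ : (ι → ℝ) → ι → ℝ}
    (h : AnalyticChart U x y π) (h' : AnalyticChart U y z ρ) :
    AnalyticChart U x z (π ∘ ρ) :=
  ⟨h'.tendsto, h.analyticAt.comp_of_eq h'.analyticAt h'.map_zero,
    by simp [h.map_zero, h'.map_zero], by
      filter_upwards [h.eventuallyEq, h'.eventuallyEq] with a h1 h2
      rw [h1, h2, Function.comp]⟩

lemma AnalyticChart.comp_analyticAt {U : Ultrafilter X} {x y : X → ι → ℝ}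
    {π : (ι → ℝ) → ι → ℝ} (h : AnalyticChart U x y π) {f : (ι → ℝ) → ℝ} (hf : AnalyticAt ℝ f 0) :
    AnalyticAt ℝ (f ∘ π) 0 :=
  hf.comp_of_eq h.analyticAt h.map_zero

lemma IsNormalCrossing.analyticAt {f : (ι → ℝ) → ℝ} {α : ι → ℕ} (h : IsNormalCrossing f α) :
    AnalyticAt ℝ f 0 := by
  obtain ⟨u, hu, -, he⟩ := h
  refine AnalyticAt.congr ?_ he.symm
  have : AnalyticAt ℝ (fun y : ι → ℝ => ∏ i, y i ^ α i) 0 :=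
    Finset.analyticAt_fun_prod _ fun i _ =>
      ((ContinuousLinearMap.proj (R := ℝ) (φ := fun _ : ι => ℝ) i).analyticAt 0).pow _
  exact this.mul hu

lemma IsNormalCrossing.comp {U : Ultrafilter X} {x y : X → ι → ℝ} {π : (ι → ℝ) → ι → ℝ}
    {A : Matrix ι ι ℕ} (h : MonomialChart U x y π A) {f : (ι → ℝ) → ℝ} {α : ι → ℕ}
    (hf : IsNormalCrossing f α) : IsNormalCrossing (f ∘ π) (Matrix.vecMul α A) := by
  obtain ⟨u, hu, hu0, he⟩ := hf
  choose v hv hv0 hve using h.isNormalCrossing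
  refine ⟨fun w => (∏ i, v i w ^ α i) * u (π w), ?_, ?_, ?_⟩
  · exact (Finset.analyticAt_fun_prod _ fun i _ => (hv i).pow _).mul
      (hu.comp_of_eq h.analyticAt h.map_zero)
  · simp only [h.map_zero]
    exact mul_ne_zero (Finset.prod_ne_zero_iff.2 fun i _ => pow_ne_zero _ (hv0 i)) hu0
  · filter_upwards [h.tendsto_map.eventually he, eventually_all.2 hve] with w h1 h2
    simp only [Function.comp, h1, h2, mul_pow, Finset.prod_mul_distrib, Matrix.vecMul,
      dotProduct, mul_assoc]
    congr 1
    simp only [← Finset.prod_pow_eq_pow_sum, ← Finset.prod_pow, ← pow_mul]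
    rw [Finset.prod_comm]
    simp only [mul_comm]

lemma MonomialChart.trans {U : Ultrafilter X} {x y z : X → ι → ℝ} {π ρ : (ι → ℝ) → ι → ℝ}
    {A B : Matrix ι ι ℕ} (h : MonomialChart U x y π A) (h' : MonomialChart U y z ρ B) :
    MonomialChart U x z (π ∘ ρ) (A * B) :=
  ⟨h.toAnalyticChart.trans h'.toAnalyticChart, fun i => by
    have : (A * B) i = Matrix.vecMul (A i) B := by ext; rfl
    rw [this]
    exact (h.isNormalCrossing i).comp h'⟩

lemma vecMul_mono (A : Matrix ι ι ℕ) {α β : ι → ℕ} (h : α ≤ β) :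
    Matrix.vecMul α A ≤ Matrix.vecMul β A := fun _ =>
  Finset.sum_le_sum fun i _ => Nat.mul_le_mul_right _ (h i)

lemma card_ne_lt {α β α' β' : ι → ℕ} {j : ι} (hj : α j ≠ β j)
    (hj' : α' j = β' j) (h : ∀ k, α' k ≠ β' k → α k ≠ β k) :
    (Finset.univ.filter fun k => α' k ≠ β' k).card < (Finset.univ.filter fun k => α k ≠ β k).card :=
  Finset.card_lt_card (Finset.ssubset_iff_of_subset (fun k => by simpa using h k) |>.2
    ⟨j, by simpa using hj, by simpa using hj'⟩)

variable [DecidableEq ι]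

lemma isNormalCrossing_apply (i : ι) :
    IsNormalCrossing (fun w : ι → ℝ => w i) (Pi.single i 1) :=
  ⟨fun _ => 1, analyticAt_const, one_ne_zero, by simp [Pi.single_apply, pow_ite]⟩

lemma MonomialChart.refl {U : Ultrafilter X} {x : X → ι → ℝ} (hx : Tendsto x U (𝓝 0)) :
    MonomialChart U x x id 1 :=
  ⟨.refl hx, fun i => by
    have : (1 : Matrix ι ι ℕ) i = Pi.single i 1 := by
      ext; simp [Matrix.one_apply, Pi.single_apply, eq_comm]
    rw [this]; exact isNormalCrossing_apply i⟩

/-- The elementary toric substitution `x j = ± s ^ a`, `x i = s ^ b * (t₀ + t)`. -/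
lemma exists_monomialChart_pair {U : Ultrafilter X} {x : X → ι → ℝ} (hx : Tendsto x U (𝓝 0))
    {i j : ι} (hij : i ≠ j) {a b : ℕ} (ha : a ≠ 0) (hb : b ≠ 0)
    (h : ∀ᶠ z in (U : Filter X), |x z i| ^ a ≤ |x z j| ^ b) :
    ∃ y π A, MonomialChart U x y π A ∧ ∃ δ : ℕ, ∀ α : ι → ℕ,
      Matrix.vecMul α A i = α i * δ ∧ Matrix.vecMul α A j = α i * b + α j * a ∧
      ∀ k, k ≠ i → k ≠ j → Matrix.vecMul α A k = α k := by
  have hxk : ∀ k, Tendsto (fun z => x z k) U (𝓝 0) := fun k => (tendsto_pi_nhds.1 hx) k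
  set s : X → ℝ := fun z => |x z j| ^ (a : ℝ)⁻¹ with hs
  have hs0 : ∀ z, 0 ≤ s z := fun z => by positivity
  have hsa : ∀ z, s z ^ a = |x z j| := fun z => Real.rpow_inv_natCast_pow (abs_nonneg _) ha
  have hst : Tendsto s U (𝓝 0) := tendsto_abs_rpow_inv (hxk j) ha
  obtain ⟨ε, hε, hεx⟩ := U.exists_eq_mul_abs fun z => x z j
  have hle : ∀ᶠ z in (U : Filter X), |x z i| ≤ s z ^ b := by
    filter_upwards [h] with z hz
    rw [← hsa, ← pow_mul, mul_comm, pow_mul] at hz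
    exact (pow_le_pow_iff_left₀ (abs_nonneg _) (pow_nonneg (hs0 z) _) ha).1 hz
  obtain ⟨t₀, ht₀⟩ := U.exists_tendsto_of_abs_le (g := fun z => x z i / s z ^ b) (C := 1) (by
    filter_upwards [hle] with z hz
    rw [abs_div, abs_of_nonneg (pow_nonneg (hs0 z) b)]
    exact div_le_one_of_le₀ hz (pow_nonneg (hs0 z) b))
  set δ : ℕ := if t₀ = 0 then 1 else 0 with hδ
  set π : (ι → ℝ) → ι → ℝ := fun w k =>
    if k = j then ε * w j ^ a else if k = i then w j ^ b * (t₀ + w i) else w k with hπ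
  set A : Matrix ι ι ℕ := fun k => if k = j then Pi.single j a else
    if k = i then Pi.single j b + Pi.single i δ else Pi.single k 1 with hA
  have hpr : ∀ k, AnalyticAt ℝ (fun w : ι → ℝ => w k) 0 := fun k =>
    (ContinuousLinearMap.proj (R := ℝ) (φ := fun _ : ι => ℝ) k).analyticAt 0
  refine ⟨fun z k => if k = j then s z else if k = i then x z i / s z ^ b - t₀ else x z k,
    π, A, ⟨⟨?_, ?_, ?_, ?_⟩, fun k => ?_⟩, δ, fun α => ⟨?_, ?_, fun k hki hkj => ?_⟩⟩
  · refine tendsto_pi_nhds.2 fun k => ?_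
    split_ifs
    · exact hst
    · simpa using ht₀.sub_const t₀
    · exact hxk k
  · refine analyticAt_pi_iff.2 fun k => ?_
    change AnalyticAt ℝ (fun w : ι → ℝ =>
      if k = j then ε * w j ^ a else if k = i then w j ^ b * (t₀ + w i) else w k) 0
    split_ifs
    · exact analyticAt_const.mul ((hpr j).pow a)
    · exact ((hpr j).pow b).mul (analyticAt_const.add (hpr i))
    · exact hpr k
  · ext k
    simp only [hπ]
    split_ifs <;> simp [ha, hb]
  · filter_upwards [hεx, hle] with z h1 h2
    ext k
    simp only [hπ, if_pos, if_neg hij]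
    split_ifs with hj hi
    · rw [hsa, ← h1, hj]
    · rw [hi]
      by_cases h0 : s z ^ b = 0
      · rw [h0] at h2
        simp [h0, abs_nonpos_iff.1 h2]
      · field_simp
        ring
    · rfl
  · by_cases hj : k = j
    · subst hj
      refine ⟨fun _ => ε, analyticAt_const, hε, Eventually.of_forall fun w => ?_⟩
      simp [hπ, hA, Pi.single_apply, pow_ite, mul_comm]
    by_cases hi : k = i
    · subst hi
      by_cases h0 : t₀ = 0
      · refine ⟨fun _ => 1, analyticAt_const, one_ne_zero, Eventually.of_forall fun w => ?_⟩
        simp only [hπ, hA, hj, if_false, if_true, Pi.add_apply, pow_add, Finset.prod_mul_distrib]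
        simp [Pi.single_apply, pow_ite, h0, hδ]
      · refine ⟨fun w => t₀ + w k, analyticAt_const.add (hpr k), by simpa using h0,
          Eventually.of_forall fun w => ?_⟩
        simp [hπ, hA, hj, Pi.single_apply, pow_ite, h0, hδ]
    · simp only [hπ, hA, if_neg hj, if_neg hi]
      exact isNormalCrossing_apply k
  · rw [Matrix.vecMul, dotProduct, Finset.sum_eq_single i]
    · simp [hA, hij]
    · intro k _ hk
      by_cases hj : k = j <;> simp [hA, hk, hj, hij, Ne.symm hk]
    · simp
  · rw [Matrix.vecMul, dotProduct, Finset.sum_eq_add i j hij]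
    · simp [hA, hij, hij.symm]
    · intro k _ hk
      simp [hA, hk.1, hk.2, Ne.symm hk.2]
    · simp
    · simp
  · rw [Matrix.vecMul, dotProduct, Finset.sum_eq_single k]
    · simp [hA, hki, hkj]
    · intro l _ hl
      by_cases hj : l = j
      · simp [hA, hj, hkj]
      by_cases hi : l = i
      · subst hi; simp [hA, hj, hkj, hki]
      · simp [hA, hj, hi, Ne.symm hl]
    · simp

/-- Along an ultrafilter, two monomials become comparable after a monomial substitution. -/
theorem exists_monomialChart_le_or_le {U : Ultrafilter X} {x : X → ι → ℝ}
    (hx : Tendsto x U (𝓝 0)) (α β : ι → ℕ) :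
    ∃ y π A, MonomialChart U x y π A ∧
      (Matrix.vecMul α A ≤ Matrix.vecMul β A ∨ Matrix.vecMul β A ≤ Matrix.vecMul α A) := by
  induction hN : (Finset.univ.filter fun k => α k ≠ β k).card using Nat.strong_induction_on
    generalizing x α β with
  | _ N ih =>
    by_cases h1 : α ≤ β
    · exact ⟨x, id, 1, .refl hx, Or.inl (vecMul_mono _ h1)⟩
    by_cases h2 : β ≤ α
    · exact ⟨x, id, 1, .refl hx, Or.inr (vecMul_mono _ h2)⟩
    simp only [Pi.le_def, not_forall, not_le] at h1 h2
    obtain ⟨i, hi⟩ := h1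
    obtain ⟨j, hj⟩ := h2
    have hij : i ≠ j := by rintro rfl; omega
    obtain ⟨p, hp⟩ := Nat.exists_eq_add_of_lt hi
    obtain ⟨q, hq⟩ := Nat.exists_eq_add_of_lt hj
    have key : ∃ y π A, MonomialChart U x y π A ∧
        (Finset.univ.filter fun k => Matrix.vecMul α A k ≠ Matrix.vecMul β A k).card < N := by
      rcases U.em (fun z => |x z i| ^ (p + 1) ≤ |x z j| ^ (q + 1)) with h | h
      · obtain ⟨y, π, A, hc, δ, hA⟩ := exists_monomialChart_pair hx hij (Nat.add_one_ne_zero p)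
          (Nat.add_one_ne_zero q) h
        refine ⟨y, π, A, hc, hN ▸ card_ne_lt (j := j) hj.ne ?_ fun k hk => ?_⟩
        · rw [(hA α).2.1, (hA β).2.1, hp, hq]; ring
        · by_cases hki : k = i
          · subst hki; exact hi.ne'
          by_cases hkj : k = j
          · subst hkj; exact hj.ne
          rwa [(hA α).2.2 k hki hkj, (hA β).2.2 k hki hkj] at hk
      · obtain ⟨y, π, A, hc, δ, hA⟩ := exists_monomialChart_pair hx hij.symm (Nat.add_one_ne_zero q)
          (Nat.add_one_ne_zero p) (h.mono fun z hz => (not_le.1 hz).le)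
        refine ⟨y, π, A, hc, hN ▸ card_ne_lt (j := i) hi.ne' ?_ fun k hk => ?_⟩
        · rw [(hA α).2.1, (hA β).2.1, hp, hq]; ring
        · by_cases hki : k = i
          · subst hki; exact hi.ne'
          by_cases hkj : k = j
          · subst hkj; exact hj.ne
          rwa [(hA α).2.2 k hkj hki, (hA β).2.2 k hkj hki] at hk
    obtain ⟨y, π, A, hc, hlt⟩ := key
    obtain ⟨z, ρ, B, hc', h⟩ := ih _ hlt hc.tendsto _ _ rfl
    refine ⟨z, π ∘ ρ, A * B, hc.trans hc', ?_⟩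
    simpa only [Matrix.vecMul_vecMul] using h

/-- Along an ultrafilter, one of finitely many monomials divides all the others after a monomial
substitution. -/
theorem exists_monomialChart_forall_le {κ : Type*} {U : Ultrafilter X} {x : X → ι → ℝ}
    (hx : Tendsto x U (𝓝 0)) {s : Finset κ} (hs : s.Nonempty) (δ : κ → ι → ℕ) :
    ∃ y π A, MonomialChart U x y π A ∧
      ∃ k ∈ s, ∀ l ∈ s, Matrix.vecMul (δ k) A ≤ Matrix.vecMul (δ l) A := by
  induction hs using Finset.Nonempty.cons_induction with
  | singleton k => exact ⟨x, id, 1, .refl hx, k, by simp⟩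
  | cons m s hm hs ih =>
    obtain ⟨y, π, A, hc, k, hk, hkl⟩ := ih
    obtain ⟨z, ρ, B, hc', h⟩ := exists_monomialChart_le_or_le hc.tendsto
      (Matrix.vecMul (δ k) A) (Matrix.vecMul (δ m) A)
    have hkl' := fun l hl => vecMul_mono B (hkl l hl)
    simp only [Matrix.vecMul_vecMul] at h hkl'
    refine ⟨z, π ∘ ρ, A * B, hc.trans hc', ?_⟩
    rcases h with h | h
    · refine ⟨k, Finset.mem_cons_of_mem hk, fun l hl => ?_⟩
      rcases Finset.mem_cons.1 hl with rfl | hl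
      · exact h
      · exact hkl' l hl
    · refine ⟨m, Finset.mem_cons_self _ _, fun l hl => ?_⟩
      rcases Finset.mem_cons.1 hl with rfl | hl
      · exact le_rfl
      · exact h.trans (hkl' l hl)

/-- Extraction of roots of the coordinates. -/
theorem exists_monomialChart_smul {U : Ultrafilter X} {x : X → ι → ℝ}
    (hx : Tendsto x U (𝓝 0)) {N : ℕ} (hN : N ≠ 0) :
    ∃ y π A, MonomialChart U x y π A ∧ ∀ α : ι → ℕ, Matrix.vecMul α A = N • α := by
  have hxk : ∀ k, Tendsto (fun z => x z k) U (𝓝 0) := fun k => (tendsto_pi_nhds.1 hx) k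
  choose ε hε hεx using fun k => U.exists_eq_mul_abs fun z => x z k
  refine ⟨fun z k => |x z k| ^ (N : ℝ)⁻¹, fun w k => ε k * w k ^ N,
    Matrix.diagonal fun _ => N, ⟨⟨?_, ?_, ?_, ?_⟩, fun k => ?_⟩, fun α => ?_⟩
  · exact tendsto_pi_nhds.2 fun k => tendsto_abs_rpow_inv (hxk k) hN
  · exact analyticAt_pi_iff.2 fun k => analyticAt_const.mul
      (((ContinuousLinearMap.proj (R := ℝ) (φ := fun _ : ι => ℝ) k).analyticAt 0).pow N)
  · ext k; simp [hN]
  · filter_upwards [eventually_all.2 hεx] with z hz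
    ext k
    rw [Real.rpow_inv_natCast_pow (abs_nonneg _) hN, ← hz k]
  · refine ⟨fun _ => ε k, analyticAt_const, hε k, Eventually.of_forall fun w => ?_⟩
    simp [Matrix.diagonal_apply, pow_ite, mul_comm]
  · ext k
    simp [Matrix.vecMul_diagonal, mul_comm]

end Toric

section Factor

/-- The ring of germs of analytic functions is a domain. -/
theorem AnalyticAt.eventually_eq_zero_or_of_mul {E : Type*} [NormedAddCommGroup E]
    [NormedSpace ℝ E] {f g : E → ℝ} {x : E} (hf : AnalyticAt ℝ f x) (hg : AnalyticAt ℝ g x)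
    (h : ∀ᶠ w in 𝓝 x, f w * g w = 0) : (∀ᶠ w in 𝓝 x, f w = 0) ∨ ∀ᶠ w in 𝓝 x, g w = 0 := by
  obtain ⟨r, hr, hb⟩ := Metric.eventually_nhds_iff_ball.1
    ((hf.eventually_analyticAt.and hg.eventually_analyticAt).and h)
  by_cases h0 : ∀ w ∈ Metric.ball x r, f w = 0
  · exact Or.inl (Metric.eventually_nhds_iff_ball.2 ⟨r, hr, h0⟩)
  push Not at h0
  obtain ⟨w, hw, hfw⟩ := h0
  have hgw : g =ᶠ[𝓝 w] 0 := by
    filter_upwards [(hb w hw).1.1.continuousAt.eventually_ne hfw,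
      Metric.isOpen_ball.mem_nhds hw] with v hv hvb
    exact (mul_eq_zero.1 (hb v hvb).2).resolve_left hv
  have hga : AnalyticOnNhd ℝ g (Metric.ball x r) := fun v hv => (hb v hv).1.2
  exact Or.inr (Metric.eventually_nhds_iff_ball.2 ⟨r, hr,
    hga.eqOn_zero_of_preconnected_of_eventuallyEq_zero
      (convex_ball x r).isPreconnected hw hgw⟩)

theorem AnalyticAt.eventually_prod_eq_zero {E κ : Type*} [NormedAddCommGroup E]
    [NormedSpace ℝ E] {f : κ → E → ℝ} {x : E} (s : Finset κ) (hf : ∀ k ∈ s, AnalyticAt ℝ (f k) x)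
    (h : ∀ᶠ w in 𝓝 x, ∏ k ∈ s, f k w = 0) : ∃ k ∈ s, ∀ᶠ w in 𝓝 x, f k w = 0 := by
  classical
  induction s using Finset.induction_on with
  | empty => simpa using h.self_of_nhds
  | insert a s ha ih =>
    simp only [Finset.prod_insert ha] at h
    rcases (hf a (Finset.mem_insert_self a s)).eventually_eq_zero_or_of_mul
      (Finset.analyticAt_fun_prod s fun k hk => hf k (Finset.mem_insert_of_mem hk)) h with h | h
    · exact ⟨a, Finset.mem_insert_self a s, h⟩
    · obtain ⟨k, hk, hk'⟩ := ih (fun k hk => hf k (Finset.mem_insert_of_mem hk)) h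
      exact ⟨k, Finset.mem_insert_of_mem hk, hk'⟩

lemma not_eventually_apply_eq_zero {ι : Type*} (i : ι) : ¬ ∀ᶠ w in 𝓝 (0 : ι → ℝ), w i = 0 := by
  intro h
  have hc : Continuous fun (t : ℝ) (_ : ι) => t := by fun_prop
  have h2 : ∀ᶠ t in 𝓝[≠] (0 : ℝ), t = 0 := ((hc.tendsto 0).eventually h).filter_mono nhdsWithin_le_nhds
  obtain ⟨t, ht, ht'⟩ := (h2.and self_mem_nhdsWithin).exists
  exact ht' ht

variable {ι : Type*} [Fintype ι]

lemma analyticAt_pi_apply (i : ι) (x : ι → ℝ) : AnalyticAt ℝ (fun w : ι → ℝ => w i) x :=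
  (ContinuousLinearMap.proj (R := ℝ) (φ := fun _ : ι => ℝ) i).analyticAt x

lemma AnalyticAt.eventually_eq_of_apply_mul_eq {f g : (ι → ℝ) → ℝ} (hf : AnalyticAt ℝ f 0)
    (hg : AnalyticAt ℝ g 0) (i : ι) (h : ∀ᶠ w in 𝓝 0, w i * f w = w i * g w) :
    f =ᶠ[𝓝 0] g := by
  have h2 := ((analyticAt_pi_apply i 0).eventually_eq_zero_or_of_mul (hf.sub hg)
    (h.mono fun w hw => by simp only [Pi.sub_apply, mul_sub, hw, sub_self])).resolve_left
    (not_eventually_apply_eq_zero i)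
  exact h2.mono fun w hw => sub_eq_zero.1 hw

variable [DecidableEq ι]

/-- A coordinate function is a prime element of the ring of analytic germs. -/
lemma AnalyticAt.exists_eq_apply_mul_or {g h : (ι → ℝ) → ℝ} (hg : AnalyticAt ℝ g 0)
    (hh : AnalyticAt ℝ h 0) (i : ι) {k : (ι → ℝ) → ℝ}
    (hk : ∀ᶠ w in 𝓝 0, g w * h w = w i * k w) :
    (∃ g', AnalyticAt ℝ g' 0 ∧ ∀ᶠ w in 𝓝 0, g w = w i * g' w) ∨
      ∃ h', AnalyticAt ℝ h' 0 ∧ ∀ᶠ w in 𝓝 0, h w = w i * h' w := by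
  set L := ContinuousLinearMap.proj (R := ℝ) (φ := fun _ : ι => ℝ) i
  set P : (ι → ℝ) → ι → ℝ := fun w => w - L w • Pi.single i (1 : ℝ) with hP
  have hPa : AnalyticAt ℝ P 0 := by
    exact analyticAt_id.sub ((L.analyticAt 0).smul analyticAt_const)
  have hP0 : P 0 = 0 := by simp [hP]
  have hPi : ∀ w, P w i = 0 := fun w => by simp [hP, L]
  have hPt : Tendsto P (𝓝 0) (𝓝 0) := by simpa [hP0] using hPa.continuousAt.tendsto
  have h0 : ∀ᶠ w in 𝓝 0, g (P w) * h (P w) = 0 := by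
    filter_upwards [hPt.eventually hk] with w hw
    rw [hw, hPi, zero_mul]
  rcases (hg.comp_of_eq hPa hP0).eventually_eq_zero_or_of_mul (hh.comp_of_eq hPa hP0) h0
    with h1 | h1
  · obtain ⟨g', hg', he⟩ := hg.exists_eq_add_mul L (Pi.single i 1)
    refine Or.inl ⟨g', hg', ?_⟩
    filter_upwards [he, h1] with w h2 h3
    rw [h2, show g (w - L w • Pi.single i (1 : ℝ)) = 0 from h3, zero_add]
    rfl
  · obtain ⟨h', hh', he⟩ := hh.exists_eq_add_mul L (Pi.single i 1)
    refine Or.inr ⟨h', hh', ?_⟩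
    filter_upwards [he, h1] with w h2 h3
    rw [h2, show h (w - L w • Pi.single i (1 : ℝ)) = 0 from h3, zero_add]
    rfl

lemma prod_pow_add_single (w : ι → ℝ) (α : ι → ℕ) (i : ι) :
    ∏ j, w j ^ (α + Pi.single i 1 : ι → ℕ) j = w i * ∏ j, w j ^ α j := by
  simp only [Pi.add_apply, pow_add, Finset.prod_mul_distrib]
  rw [mul_comm]
  congr 1
  simp [Pi.single_apply, pow_ite]

lemma IsNormalCrossing.mul_apply {f : (ι → ℝ) → ℝ} {α : ι → ℕ} (h : IsNormalCrossing f α)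
    (i : ι) : IsNormalCrossing (fun w => w i * f w) (α + Pi.single i 1) := by
  obtain ⟨u, hu, hu0, he⟩ := h
  refine ⟨u, hu, hu0, ?_⟩
  filter_upwards [he] with w hw
  rw [hw, prod_pow_add_single, mul_assoc]

/-- A factor of a normal crossing is a normal crossing. -/
theorem IsNormalCrossing.of_mul {g h : (ι → ℝ) → ℝ} {α : ι → ℕ} (hg : AnalyticAt ℝ g 0)
    (hh : AnalyticAt ℝ h 0) (hα : IsNormalCrossing (fun w => g w * h w) α) :
    ∃ β, IsNormalCrossing g β := by
  induction hN : ∑ i, α i generalizing g h α with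
  | zero =>
    have hα0 : ∀ i, α i = 0 := fun i => by simpa using (Finset.sum_eq_zero_iff.1 hN) i
    obtain ⟨u, hu, hu0, he⟩ := hα
    have := he.self_of_nhds
    simp only [hα0, pow_zero, Finset.prod_const_one, one_mul] at this
    exact ⟨0, g, hg, left_ne_zero_of_mul (this ▸ hu0), by simp⟩
  | succ N ih =>
    obtain ⟨i, hi⟩ : ∃ i, α i ≠ 0 := by
      by_contra! h0
      simp [h0] at hN
    obtain ⟨β, rfl⟩ : ∃ β, α = β + Pi.single i 1 := by
      refine ⟨α - Pi.single i 1, (tsub_add_cancel_of_le fun j => ?_).symm⟩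
      by_cases hj : j = i
      · subst hj; simpa using Nat.one_le_iff_ne_zero.2 hi
      · simp [hj]
    have hβ : ∑ i, β i = N := by
      simpa [Finset.sum_add_distrib] using hN
    obtain ⟨u, hu, hu0, he⟩ := hα
    simp only [prod_pow_add_single, mul_assoc] at he
    have hm : IsNormalCrossing (fun w => (∏ j, w j ^ β j) * u w) β := ⟨u, hu, hu0, by simp⟩
    rcases hg.exists_eq_apply_mul_or hh i he with ⟨g', hg', hge⟩ | ⟨h', hh', hhe⟩
    · have : (fun w => g' w * h w) =ᶠ[𝓝 0] fun w => (∏ j, w j ^ β j) * u w := by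
        refine (hg'.mul hh).eventually_eq_of_apply_mul_eq hm.analyticAt i ?_
        filter_upwards [he, hge] with w h1 h2
        rw [← h1, h2, Pi.mul_apply, mul_assoc]
      obtain ⟨γ, hγ⟩ := ih hg' hh (hm.congr this) hβ
      exact ⟨_, (hγ.mul_apply i).congr hge⟩
    · have : (fun w => g w * h' w) =ᶠ[𝓝 0] fun w => (∏ j, w j ^ β j) * u w := by
        refine (hg.mul hh').eventually_eq_of_apply_mul_eq hm.analyticAt i ?_
        filter_upwards [he, hhe] with w h1 h2
        rw [← h1, h2, Pi.mul_apply, mul_left_comm]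
      exact ih hg hh' (hm.congr this) hβ

end Factor

section Uniformization

/-- Local uniformization along the ultrafilter `U` in dimension `n`. -/
def UniformizesAlong {X : Type*} (U : Ultrafilter X) (n : ℕ) : Prop :=
  ∀ (x : X → Fin n → ℝ) (f : (Fin n → ℝ) → ℝ), Tendsto x U (𝓝 0) → AnalyticAt ℝ f 0 →
    (¬ ∀ᶠ w in 𝓝 0, f w = 0) →
    ∃ y π α, AnalyticChart U x y π ∧ IsNormalCrossing (f ∘ π) α

/-- Simultaneous local uniformization of finitely many functions. -/
lemma UniformizesAlong.finset {X κ : Type*} {U : Ultrafilter X} {n : ℕ}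
    (h : UniformizesAlong U n) {x : X → Fin n → ℝ} (hx : Tendsto x U (𝓝 0)) (s : Finset κ)
    (f : κ → (Fin n → ℝ) → ℝ) (hf : ∀ k ∈ s, AnalyticAt ℝ (f k) 0)
    (hf0 : ∀ k ∈ s, ¬ ∀ᶠ w in 𝓝 0, f k w = 0) :
    ∃ y π, AnalyticChart U x y π ∧ ∀ k ∈ s, ∃ α, IsNormalCrossing (f k ∘ π) α := by
  classical
  obtain ⟨y, π, α, hc, hα⟩ := h x (fun w => ∏ k ∈ s, f k w) hx
    (Finset.analyticAt_fun_prod s hf) fun h0 => by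
      obtain ⟨k, hk, hk0⟩ := AnalyticAt.eventually_prod_eq_zero s hf h0
      exact hf0 k hk hk0
  refine ⟨y, π, hc, fun k hk => ?_⟩
  refine IsNormalCrossing.of_mul (h := fun w => ∏ l ∈ s.erase k, f l (π w))
    (hc.comp_analyticAt (hf k hk))
    (Finset.analyticAt_fun_prod _ fun l hl =>
      hc.comp_analyticAt (hf l (Finset.mem_of_mem_erase hl))) (hα.congr ?_)
  exact Eventually.of_forall fun w => Finset.mul_prod_erase s (fun l => f l (π w)) hk

end Uniformization

section NormalCrossing

variable {ι : Type*} [Fintype ι]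

lemma isNormalCrossing_of_ne_zero {u : (ι → ℝ) → ℝ} (hu : AnalyticAt ℝ u 0) (hu0 : u 0 ≠ 0) :
    IsNormalCrossing u 0 :=
  ⟨u, hu, hu0, by simp⟩

lemma isNormalCrossing_monomial (α : ι → ℕ) :
    IsNormalCrossing (fun w : ι → ℝ => ∏ i, w i ^ α i) α :=
  ⟨fun _ => 1, analyticAt_const, one_ne_zero, by simp⟩

lemma IsNormalCrossing.mul {f g : (ι → ℝ) → ℝ} {α β : ι → ℕ} (hf : IsNormalCrossing f α)
    (hg : IsNormalCrossing g β) : IsNormalCrossing (fun w => f w * g w) (α + β) := by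
  obtain ⟨u, hu, hu0, hue⟩ := hf
  obtain ⟨v, hv, hv0, hve⟩ := hg
  refine ⟨fun w => u w * v w, hu.mul hv, mul_ne_zero hu0 hv0, ?_⟩
  filter_upwards [hue, hve] with w h1 h2
  simp only [h1, h2, Pi.add_apply, pow_add, Finset.prod_mul_distrib]
  ring

lemma IsNormalCrossing.pow {f : (ι → ℝ) → ℝ} {α : ι → ℕ} (hf : IsNormalCrossing f α) (k : ℕ) :
    IsNormalCrossing (fun w => f w ^ k) (k • α) := by
  induction k with
  | zero => simpa using isNormalCrossing_of_ne_zero (ι := ι) analyticAt_const one_ne_zero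
  | succ k ih => simpa only [pow_succ, succ_nsmul] using ih.mul hf

lemma IsNormalCrossing.exists_prod {κ : Type*} (s : Finset κ) {f : κ → (ι → ℝ) → ℝ}
    (hf : ∀ k ∈ s, ∃ α, IsNormalCrossing (f k) α) :
    ∃ α, IsNormalCrossing (fun w => ∏ k ∈ s, f k w) α := by
  classical
  induction s using Finset.induction_on with
  | empty => exact ⟨0, by simpa using isNormalCrossing_of_ne_zero (ι := ι) analyticAt_const one_ne_zero⟩
  | insert a s ha ih =>
    obtain ⟨α, hα⟩ := ih fun k hk => hf k (Finset.mem_insert_of_mem hk)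
    obtain ⟨β, hβ⟩ := hf a (Finset.mem_insert_self a s)
    simp only [Finset.prod_insert ha]
    exact ⟨_, hβ.mul hα⟩

/-- Pullback of a normal crossing under a map whose relevant components are normal crossings. -/
lemma IsNormalCrossing.exists_comp {f : (ι → ℝ) → ℝ} {α : ι → ℕ} (hf : IsNormalCrossing f α)
    {π : (ι → ℝ) → ι → ℝ} (hπ : AnalyticAt ℝ π 0) (hπ0 : π 0 = 0)
    (h : ∀ i, α i ≠ 0 → ∃ β, IsNormalCrossing (fun w => π w i) β) :
    ∃ β, IsNormalCrossing (f ∘ π) β := by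
  obtain ⟨u, hu, hu0, hue⟩ := hf
  obtain ⟨β, hβ⟩ := IsNormalCrossing.exists_prod (f := fun i w => π w i ^ α i) Finset.univ
    fun i _ => by
      by_cases hi : α i = 0
      · exact ⟨0, by
          simpa [hi] using isNormalCrossing_of_ne_zero (ι := ι) analyticAt_const one_ne_zero⟩
      · obtain ⟨β, hβ⟩ := h i hi
        exact ⟨_, hβ.pow _⟩
  refine ⟨_, (hβ.mul (isNormalCrossing_of_ne_zero (hu.comp_of_eq hπ hπ0)
    (by simpa [hπ0] using hu0))).congr ?_⟩
  have ht : Tendsto π (𝓝 0) (𝓝 0) := by simpa [hπ0] using hπ.continuousAt.tendsto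
  exact ht.eventually hue

lemma IsNormalCrossing.apply_zero {f : (ι → ℝ) → ℝ} {α : ι → ℕ} (hf : IsNormalCrossing f α) :
    f 0 = 0 ↔ α ≠ 0 := by
  obtain ⟨u, hu, hu0, hue⟩ := hf
  rw [hue.self_of_nhds, mul_eq_zero, or_iff_left hu0, Finset.prod_eq_zero_iff, Function.ne_iff]
  simp

lemma IsNormalCrossing.exists_eq_mul {f g : (ι → ℝ) → ℝ} {α β : ι → ℕ}
    (hf : IsNormalCrossing f α) (hg : IsNormalCrossing g β) (h : α ≤ β) :
    ∃ k, IsNormalCrossing k (β - α) ∧ ∀ᶠ w in 𝓝 0, g w = f w * k w := by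
  obtain ⟨u, hu, hu0, hue⟩ := hf
  obtain ⟨v, hv, hv0, hve⟩ := hg
  refine ⟨fun w => (∏ i, w i ^ (β - α) i) * (v w / u w),
    ⟨fun w => v w / u w, hv.div hu hu0, div_ne_zero hv0 hu0, by simp⟩, ?_⟩
  filter_upwards [hue, hve, hu.continuousAt.eventually_ne hu0] with w h1 h2 h3
  have : ∏ i, w i ^ β i = (∏ i, w i ^ α i) * ∏ i, w i ^ (β - α) i := by
    rw [← Finset.prod_mul_distrib]
    exact Finset.prod_congr rfl fun i _ => by
      rw [← pow_add, Pi.sub_apply, Nat.add_sub_cancel' (h i)]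
  rw [h1, h2, this]
  field_simp

/-- The weighted minimum of finitely many normal crossings can be made a monomial. -/
lemma exists_monomialChart_weighted [DecidableEq ι] {X : Type*} {U : Ultrafilter X}
    {x : X → ι → ℝ} (hx : Tendsto x U (𝓝 0)) {s : Finset ℕ} (hs : s.Nonempty) {d : ℕ}
    (hsd : ∀ i ∈ s, i < d) {c : ℕ → (ι → ℝ) → ℝ} {γ : ℕ → ι → ℕ}
    (hc : ∀ i ∈ s, IsNormalCrossing (c i) (γ i)) :
    ∃ y π A, MonomialChart U x y π A ∧ ∃ (α : ι → ℕ) (b : ℕ → (ι → ℝ) → ℝ),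
      (∀ i ∈ s, AnalyticAt ℝ (b i) 0) ∧ (∃ i ∈ s, b i 0 ≠ 0) ∧
      ∀ i ∈ s, ∀ᶠ w in 𝓝 0, c i (π w) = (∏ j, w j ^ α j) ^ (d - i) * b i w := by
  obtain ⟨y, π, A, h1, k, hk, hmin⟩ := exists_monomialChart_forall_le hx hs
    fun i => (d.factorial / (d - i)) • γ i
  obtain ⟨z, ρ, B, h2, hB⟩ := exists_monomialChart_smul h1.tendsto d.factorial_ne_zero
  set α := Matrix.vecMul ((d.factorial / (d - k)) • γ k) A
  have hfac : ∀ i ∈ s, d.factorial = (d - i) * (d.factorial / (d - i)) := fun i hi =>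
    (Nat.mul_div_cancel' (Nat.dvd_factorial (by have := hsd i hi; omega) (Nat.sub_le _ _))).symm
  have hexp : ∀ i ∈ s, Matrix.vecMul (γ i) (A * B)
      = (d - i) • Matrix.vecMul ((d.factorial / (d - i)) • γ i) A := fun i hi => by
    rw [← Matrix.vecMul_vecMul, hB, Matrix.smul_vecMul, smul_smul, ← hfac i hi]
  have hle : ∀ i ∈ s, (d - i) • α ≤ Matrix.vecMul (γ i) (A * B) := fun i hi => by
    rw [hexp i hi]
    exact fun j => Nat.mul_le_mul_left _ (hmin i hi j)
  have hq : ∀ i ∈ s, ∃ b, IsNormalCrossing b (Matrix.vecMul (γ i) (A * B) - (d - i) • α) ∧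
      ∀ᶠ w in 𝓝 0, c i ((π ∘ ρ) w) = (∏ j, w j ^ α j) ^ (d - i) * b w := fun i hi =>
    ((isNormalCrossing_monomial α).pow (d - i)).exists_eq_mul ((hc i hi).comp (h1.trans h2))
      (hle i hi)
  choose! b hb hbe using hq
  refine ⟨z, π ∘ ρ, A * B, h1.trans h2, α, b, fun i hi => (hb i hi).analyticAt, ⟨k, hk, ?_⟩, hbe⟩
  rw [Ne, (hb k hk).apply_zero, hexp k hk, not_ne_iff]
  exact tsub_self _

end NormalCrossing

section FinCons

lemma AnalyticAt.finCons {E : Type*} [NormedAddCommGroup E] [NormedSpace ℝ E] {n : ℕ}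
    {a : E → ℝ} {b : E → Fin n → ℝ} {x : E} (ha : AnalyticAt ℝ a x) (hb : AnalyticAt ℝ b x) :
    AnalyticAt ℝ (fun w => (Fin.cons (a w) (b w) : Fin (n + 1) → ℝ)) x :=
  analyticAt_pi_iff.2 (Fin.cases ha (analyticAt_pi_iff.1 hb))

lemma analyticAt_finTail {n : ℕ} (x : Fin (n + 1) → ℝ) :
    AnalyticAt ℝ (fun w : Fin (n + 1) → ℝ => Fin.tail w) x :=
  analyticAt_pi_iff.2 fun j => analyticAt_pi_apply j.succ x

lemma finCons_zero {n : ℕ} : (Fin.cons 0 0 : Fin (n + 1) → ℝ) = 0 := by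
  ext j; cases j using Fin.cases <;> simp

lemma tendsto_finTail {X : Type*} {n : ℕ} {x : X → Fin (n + 1) → ℝ} {l : Filter X}
    (hx : Tendsto x l (𝓝 0)) : Tendsto (fun a => Fin.tail (x a)) l (𝓝 0) :=
  tendsto_pi_nhds.2 fun j => tendsto_pi_nhds.1 hx j.succ

lemma tendsto_finCons {X : Type*} {n : ℕ} {z : X → ℝ} {y : X → Fin n → ℝ} {l : Filter X}
    (hz : Tendsto z l (𝓝 0)) (hy : Tendsto y l (𝓝 0)) :
    Tendsto (fun a => (Fin.cons (z a) (y a) : Fin (n + 1) → ℝ)) l (𝓝 0) :=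
  tendsto_pi_nhds.2 (Fin.cases hz (tendsto_pi_nhds.1 hy))

lemma IsNormalCrossing.comp_tail {n : ℕ} {f : (Fin n → ℝ) → ℝ} {α : Fin n → ℕ}
    (hf : IsNormalCrossing f α) :
    IsNormalCrossing (fun w : Fin (n + 1) → ℝ => f (Fin.tail w)) (Fin.cons 0 α) := by
  obtain ⟨u, hu, hu0, hue⟩ := hf
  refine ⟨fun w => u (Fin.tail w), hu.comp_of_eq (analyticAt_finTail 0) rfl, hu0, ?_⟩
  filter_upwards [(tendsto_finTail tendsto_id).eventually hue] with w hw
  rw [id] at hw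
  rw [hw, Fin.prod_univ_succ]
  simp [Fin.tail]

lemma AnalyticChart.cons {X : Type*} {U : Ultrafilter X} {n : ℕ} {x : X → Fin (n + 1) → ℝ}
    (hx : Tendsto x U (𝓝 0)) {y : X → Fin n → ℝ} {π : (Fin n → ℝ) → Fin n → ℝ}
    (h : AnalyticChart U (fun a => Fin.tail (x a)) y π) :
    AnalyticChart U x (fun a => Fin.cons (x a 0) (y a))
      (fun w => Fin.cons (w 0) (π (Fin.tail w))) := by
  refine ⟨tendsto_finCons (tendsto_pi_nhds.1 hx 0) h.tendsto,
    (analyticAt_pi_apply 0 0).finCons (h.analyticAt.comp_of_eq (analyticAt_finTail 0) rfl), ?_, ?_⟩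
  · have : π (Fin.tail (0 : Fin (n + 1) → ℝ)) = 0 := h.map_zero
    simp [this, finCons_zero]
  · filter_upwards [h.eventuallyEq] with a ha
    simp [← ha]

end FinCons

section Regular

variable {X : Type*} {U : Ultrafilter X} {n : ℕ}

/-- The function `g` becomes a normal crossing in a chart at `x` whose components other than the
first are also normal crossings. -/
def RegularlyUniformizes (U : Ultrafilter X) (x : X → Fin (n + 1) → ℝ)
    (g : (Fin (n + 1) → ℝ) → ℝ) : Prop :=
  ∃ y π, AnalyticChart U x y π ∧ (∃ α, IsNormalCrossing (g ∘ π) α) ∧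
    ∀ j : Fin n, ∃ α, IsNormalCrossing (fun w => π w j.succ) α

lemma RegularlyUniformizes.of_chart {x y : X → Fin (n + 1) → ℝ}
    {g g' m : (Fin (n + 1) → ℝ) → ℝ} {π : (Fin (n + 1) → ℝ) → Fin (n + 1) → ℝ}
    (hπ : AnalyticChart U x y π)
    (hπs : ∀ j : Fin n, ∃ α : Fin n → ℕ, IsNormalCrossing (fun w => π w j.succ) (Fin.cons 0 α))
    {γ : Fin n → ℕ} (hm : IsNormalCrossing m (Fin.cons 0 γ))
    (hg : ∀ᶠ w in 𝓝 0, g (π w) = m w * g' w) (h : RegularlyUniformizes U y g') :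
    RegularlyUniformizes U x g := by
  obtain ⟨z, ρ, hρ, ⟨α, hα⟩, hs⟩ := h
  have hcomp : ∀ {f : (Fin (n + 1) → ℝ) → ℝ} {β : Fin n → ℕ},
      IsNormalCrossing f (Fin.cons 0 β) → ∃ δ, IsNormalCrossing (f ∘ ρ) δ := fun hf =>
    hf.exists_comp hρ.analyticAt hρ.map_zero
      (Fin.cases (fun h0 => (h0 rfl).elim) fun j _ => hs j)
  refine ⟨z, π ∘ ρ, hπ.trans hρ, ?_, fun j => ?_⟩
  · obtain ⟨δ, hδ⟩ := hcomp hm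
    exact ⟨_, (hδ.mul hα).congr (hρ.tendsto_map.eventually hg)⟩
  · obtain ⟨β, hβ⟩ := hπs j
    exact hcomp hβ

end Regular

section RegularStep

variable {X : Type*} {U : Ultrafilter X} {n : ℕ}

/-- Local uniformization of functions regular of order `d` in the first variable. -/
def UniformizesRegular (U : Ultrafilter X) (n d : ℕ) : Prop :=
  ∀ (x : X → Fin (n + 1) → ℝ) (g : (Fin (n + 1) → ℝ) → ℝ) (v : ℝ → ℝ), Tendsto x U (𝓝 0) →
    AnalyticAt ℝ g 0 → AnalyticAt ℝ v 0 → v 0 ≠ 0 →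
    (∀ᶠ z in 𝓝 0, g (Fin.cons z 0) = z ^ d * v z) → RegularlyUniformizes U x g

open Polynomial in
/-- A polynomial of degree `m + 1` without term of degree `m` which is not a monomial has no root of
multiplicity `m + 1`. -/
lemma exists_eval_add_eq_pow_mul {m : ℕ} {b : ℕ → ℝ} {a : ℝ} (ha : a ≠ 0)
    (hb : ∃ i < m, b i ≠ 0) (t : ℝ) :
    ∃ e < m + 1, ∃ v : ℝ → ℝ, AnalyticAt ℝ v 0 ∧ v 0 ≠ 0 ∧
      ∀ z, ∑ i ∈ Finset.range m, b i * (t + z) ^ i + a * (t + z) ^ (m + 1) = z ^ e * v z := by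
  set p : ℝ[X] := ∑ i ∈ Finset.range m, C (b i) * X ^ i + C a * X ^ (m + 1) with hp
  have hcoeff : ∀ k, p.coeff k = (if k < m then b k else 0) + if k = m + 1 then a else 0 := by
    intro k
    simp [hp, Polynomial.coeff_X_pow]
  have hp0 : p ≠ 0 := fun h => by
    have := hcoeff (m + 1)
    simp [h] at this
    exact ha this.symm
  have hdeg : p.natDegree ≤ m + 1 := by
    refine Polynomial.natDegree_le_iff_coeff_eq_zero.2 fun k hk => ?_
    rw [hcoeff, if_neg (by omega), if_neg (by omega), add_zero]
  obtain ⟨q, hq, hqt⟩ := Polynomial.exists_eq_pow_rootMultiplicity_mul_and_not_dvd p hp0 t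
  rw [Polynomial.dvd_iff_isRoot] at hqt
  have hq0 : q ≠ 0 := by rintro rfl; simp at hqt
  set e := p.rootMultiplicity t
  have hmonic : ((X - C t) ^ e).Monic := (Polynomial.monic_X_sub_C t).pow e
  have hdq : p.natDegree = e + q.natDegree := by
    rw [hq, hmonic.natDegree_mul' hq0, Polynomial.natDegree_pow, Polynomial.natDegree_X_sub_C,
      mul_one]
  refine ⟨e, ?_, fun z => q.eval (t + z), ?_, by simpa using hqt, fun z => ?_⟩
  · by_contra! hlt
    have he : e = m + 1 := by omega
    have hqc : q = C (q.coeff 0) := Polynomial.eq_C_of_natDegree_eq_zero (by omega)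
    rw [he, hqc] at hq
    have hk : ∀ k, p.coeff k = (-t) ^ (m + 1 - k) * ((m + 1).choose k : ℝ) * q.coeff 0 := by
      intro k
      rw [hq, Polynomial.coeff_mul_C, sub_eq_add_neg, ← Polynomial.C_neg,
        Polynomial.coeff_X_add_C_pow]
    have h1 := (hk (m + 1)).symm.trans (hcoeff (m + 1))
    have h2 := (hk m).symm.trans (hcoeff m)
    simp at h1 h2
    rw [h1] at h2
    have ht : t = 0 := by
      rcases h2 with (h2 | h2) | h2
      · exact h2
      · exact absurd h2 (by positivity)
      · exact absurd h2 ha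
    obtain ⟨i, hi, hbi⟩ := hb
    have h3 := (hk i).symm.trans (hcoeff i)
    rw [ht, neg_zero, zero_pow (by omega), if_pos hi, if_neg (by omega)] at h3
    simp at h3
    exact hbi h3.symm
  · have h : AnalyticAt ℝ (fun z : ℝ => t + z) 0 := analyticAt_const.add analyticAt_id
    simpa [Polynomial.aeval_def] using h.aeval_polynomial q
  · have := congrArg (Polynomial.eval (t + z)) hq
    simp only [Polynomial.eval_mul, Polynomial.eval_pow, Polynomial.eval_sub, Polynomial.eval_X,
      Polynomial.eval_C, add_sub_cancel_left] at this
    rw [← this, hp]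
    simp [Polynomial.eval_finsetSum]

/-- Uniformization when the first coordinate is dominated by the monomial governing the
coefficients: substitute `z = y ^ α * (t₀ + z')`, which lowers the order. -/
lemma regularlyUniformizes_of_bounded {m : ℕ} (ih : ∀ e < m + 1, UniformizesRegular U n e)
    {x : X → Fin (n + 1) → ℝ} (hx : Tendsto x U (𝓝 0)) {α : Fin n → ℕ} (hα : α ≠ 0)
    {b : ℕ → (Fin n → ℝ) → ℝ} (hb : ∀ i, AnalyticAt ℝ (b i) 0) (hb0 : ∃ i < m, b i 0 ≠ 0)
    {u : (Fin n → ℝ) × ℝ → ℝ} (hu : AnalyticAt ℝ u 0) (hu0 : u 0 ≠ 0) {C : ℝ}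
    (hC : ∀ᶠ a in (U : Filter X), |x a 0| ≤ C * |∏ j : Fin n, x a j.succ ^ α j|) :
    RegularlyUniformizes U x fun w =>
      ∑ i ∈ Finset.range m, ((∏ j, Fin.tail w j ^ α j) ^ (m + 1 - i) * b i (Fin.tail w)) * w 0 ^ i
        + w 0 ^ (m + 1) * u (Fin.tail w, w 0) := by
  set M : (Fin n → ℝ) → ℝ := fun y => ∏ j, y j ^ α j with hM
  have hMa : AnalyticAt ℝ M 0 := (isNormalCrossing_monomial α).analyticAt
  have hM0 : M 0 = 0 := (isNormalCrossing_monomial α).apply_zero.2 hα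
  have hMt : AnalyticAt ℝ (fun w : Fin (n + 1) → ℝ => M (Fin.tail w)) 0 :=
    hMa.comp_of_eq (analyticAt_finTail 0) rfl
  have hMt0 : M (Fin.tail (0 : Fin (n + 1) → ℝ)) = 0 := hM0
  obtain ⟨t, ht⟩ := U.exists_tendsto_of_abs_le (g := fun a => x a 0 / M (Fin.tail (x a)))
    (C := |C|) (by
      filter_upwards [hC] with a ha
      rw [abs_div]
      refine div_le_of_le_mul₀ (abs_nonneg _) (abs_nonneg _) (ha.trans ?_)
      exact mul_le_mul_of_nonneg_right (le_abs_self C) (abs_nonneg _))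
  have hline : AnalyticAt ℝ (fun w : Fin (n + 1) → ℝ => t + w 0) 0 :=
    analyticAt_const.add (analyticAt_pi_apply 0 0)
  have hchart : AnalyticChart U x
      (fun a => Fin.cons (x a 0 / M (Fin.tail (x a)) - t) (Fin.tail (x a)))
      (fun w => Fin.cons (M (Fin.tail w) * (t + w 0)) (Fin.tail w)) := by
    refine ⟨tendsto_finCons (by simpa using ht.sub_const t) (tendsto_finTail hx),
      (hMt.mul hline).finCons (analyticAt_finTail 0), ?_, ?_⟩
    · rw [hMt0, zero_mul]; exact finCons_zero
    · filter_upwards [hC] with a ha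
      have : M (Fin.tail (x a)) * (t + (x a 0 / M (Fin.tail (x a)) - t)) = x a 0 := by
        by_cases h0 : M (Fin.tail (x a)) = 0
        · have : |x a 0| ≤ 0 := by
            have h0' : ∏ j : Fin n, x a j.succ ^ α j = 0 := h0
            simpa [h0'] using ha
          rw [h0, zero_mul, abs_nonpos_iff.1 this]
        · field_simp
          ring
      simp only [Fin.tail_cons, Fin.cons_zero, this, Fin.cons_self_tail]
  obtain ⟨e, he, v, hv, hv0, hev⟩ := exists_eval_add_eq_pow_mul (b := fun i => b i 0) hu0 hb0 t
  set g' : (Fin (n + 1) → ℝ) → ℝ := fun w =>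
    ∑ i ∈ Finset.range m, b i (Fin.tail w) * (t + w 0) ^ i
      + u (Fin.tail w, M (Fin.tail w) * (t + w 0)) * (t + w 0) ^ (m + 1) with hg'
  have hg'a : AnalyticAt ℝ g' 0 := by
    refine AnalyticAt.add (Finset.analyticAt_fun_sum _ fun i _ => ?_) (AnalyticAt.mul ?_ ?_)
    · exact ((hb i).comp_of_eq (analyticAt_finTail 0) rfl).mul (hline.pow i)
    · exact hu.comp_of_eq ((analyticAt_finTail 0).prod (hMt.mul hline))
        (Prod.ext rfl (by simp [hMt0]))
    · exact hline.pow _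
  have hreg := ih e he _ g' (fun z => v z) hchart.tendsto hg'a hv hv0 (Eventually.of_forall fun z => by
      simp only [hg', Fin.tail_cons, Fin.cons_zero, hM0, zero_mul]
      exact hev z)
  refine .of_chart hchart (fun j => ⟨Pi.single j 1, ?_⟩)
    (((isNormalCrossing_monomial α).pow (m + 1)).comp_tail) (Eventually.of_forall fun w => ?_) hreg
  · exact (isNormalCrossing_apply j).comp_tail
  · simp only [Fin.tail_cons, Fin.cons_zero, hg']
    rw [mul_add (_ ^ _), Finset.mul_sum]
    congr 1
    · refine Finset.sum_congr rfl fun i hi => ?_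
      have hi := Finset.mem_range.1 hi
      change M (Fin.tail w) ^ (m + 1 - i) * _ * _ = M (Fin.tail w) ^ (m + 1) * _
      rw [mul_pow, show M (Fin.tail w) ^ (m + 1)
        = M (Fin.tail w) ^ (m + 1 - i) * M (Fin.tail w) ^ i by rw [← pow_add]; congr 1; omega]
      ring
    · rw [mul_pow, mul_assoc, mul_comm (u _)]

/-- Uniformization when the monomial governing the coefficients is negligible with respect to the
first coordinate. -/
lemma regularlyUniformizes_of_unbounded {m : ℕ}
    {x : X → Fin (n + 1) → ℝ} (hx : Tendsto x U (𝓝 0)) {α : Fin n → ℕ}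
    {b : ℕ → (Fin n → ℝ) → ℝ} (hb : ∀ i, AnalyticAt ℝ (b i) 0)
    {u : (Fin n → ℝ) × ℝ → ℝ} (hu : AnalyticAt ℝ u 0) (hu0 : u 0 ≠ 0)
    (hC : ¬ ∃ C, ∀ᶠ a in (U : Filter X), |x a 0| ≤ C * |∏ j : Fin n, x a j.succ ^ α j|) :
    RegularlyUniformizes U x fun w =>
      ∑ i ∈ Finset.range m, ((∏ j, Fin.tail w j ^ α j) ^ (m + 1 - i) * b i (Fin.tail w)) * w 0 ^ i
        + w 0 ^ (m + 1) * u (Fin.tail w, w 0) := by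
  set M : (Fin n → ℝ) → ℝ := fun y => ∏ j, y j ^ α j with hM
  obtain ⟨y, π, A, hA, hcmp⟩ := exists_monomialChart_le_or_le hx (Fin.cons 0 α)
    (Pi.single (0 : Fin (n + 1)) 1)
  have h1 : IsNormalCrossing (fun w => M (Fin.tail (π w))) (Matrix.vecMul (Fin.cons 0 α) A) :=
    (isNormalCrossing_monomial α).comp_tail.comp hA
  have h2 : IsNormalCrossing (fun w => π w 0) (Matrix.vecMul (Pi.single 0 1) A) :=
    (isNormalCrossing_apply (0 : Fin (n + 1))).comp hA
  have hπt : AnalyticAt ℝ (fun w => Fin.tail (π w)) 0 :=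
    (analyticAt_finTail 0).comp_of_eq hA.analyticAt hA.map_zero
  have hπt0 : Fin.tail (π 0) = 0 := by rw [hA.map_zero]; rfl
  rcases hcmp with hle | hle
  · obtain ⟨k, hk, hke⟩ := h1.exists_eq_mul h2 hle
    refine (hC ⟨|k 0| + 1, ?_⟩).elim
    have hkb : ∀ᶠ w in 𝓝 0, |k w| < |k 0| + 1 :=
      hk.analyticAt.continuousAt.abs.eventually_lt continuousAt_const (by simp)
    filter_upwards [hA.tendsto.eventually hke, hA.tendsto.eventually hkb, hA.eventuallyEq]
      with a h3 h4 h5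
    rw [← h5] at h3
    rw [h3, abs_mul, mul_comm]
    exact mul_le_mul_of_nonneg_right h4.le (abs_nonneg _)
  · obtain ⟨k, hk, hke⟩ := h2.exists_eq_mul h1 hle
    have hk0 : k 0 = 0 := by
      by_contra hk0
      refine hC ⟨2 / |k 0|, ?_⟩
      have hkb : ∀ᶠ w in 𝓝 0, |k 0| / 2 < |k w| :=
        continuousAt_const.eventually_lt hk.analyticAt.continuousAt.abs
          (half_lt_self (abs_pos.2 hk0))
      filter_upwards [hA.tendsto.eventually hke, hA.tendsto.eventually hkb, hA.eventuallyEq]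
        with a h3 h4 h5
      rw [← h5] at h3
      change |x a 0| ≤ 2 / |k 0| * |M (Fin.tail (x a))|
      have hp := abs_pos.2 hk0
      rw [h3, abs_mul, div_mul_eq_mul_div, le_div_iff₀ hp]
      nlinarith [abs_nonneg (x a 0)]
    set q : (Fin (n + 1) → ℝ) → ℝ := fun w =>
      ∑ i ∈ Finset.range m, k w ^ (m + 1 - i) * b i (Fin.tail (π w)) + u (Fin.tail (π w), π w 0)
      with hq
    have hqa : AnalyticAt ℝ q 0 := by
      refine AnalyticAt.add (Finset.analyticAt_fun_sum _ fun i _ => ?_) ?_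
      · exact (hk.analyticAt.pow _).mul ((hb i).comp_of_eq hπt hπt0)
      · exact hu.comp_of_eq (hπt.prod h2.analyticAt) (by rw [hA.map_zero]; rfl)
    have hq0 : q 0 ≠ 0 := by
      have : ∑ i ∈ Finset.range m, k 0 ^ (m + 1 - i) * b i (Fin.tail (π 0)) = 0 :=
        Finset.sum_eq_zero fun i hi => by
          rw [hk0, zero_pow (by have := Finset.mem_range.1 hi; omega), zero_mul]
      simp only [hq]
      rw [this, zero_add, hA.map_zero]
      exact hu0
    refine ⟨y, π, hA.toAnalyticChart,
      ⟨_, ((h2.pow (m + 1)).mul (isNormalCrossing_of_ne_zero hqa hq0)).congr ?_⟩,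
      fun j => ⟨_, hA.isNormalCrossing j.succ⟩⟩
    filter_upwards [hke] with w hw
    have hw' : ∏ j, Fin.tail (π w) j ^ α j = π w 0 * k w := hw
    simp only [Function.comp, hw', hq, mul_add, Finset.mul_sum]
    congr 1
    refine Finset.sum_congr rfl fun i hi => ?_
    have hi := Finset.mem_range.1 hi
    rw [mul_pow, show π w 0 ^ (m + 1) = π w 0 ^ (m + 1 - i) * π w 0 ^ i by
      rw [← pow_add]; congr 1; omega]
    ring

end RegularStep

section LocalUniformization

variable {X : Type*} {U : Ultrafilter X} {n : ℕ}

/-- Uniformization of a function in Tschirnhaus form. -/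
lemma regularlyUniformizes_of_tschirnhaus (hU : UniformizesAlong U n) {m : ℕ}
    (ih : ∀ e < m + 1, UniformizesRegular U n e)
    {x : X → Fin (n + 1) → ℝ} (hx : Tendsto x U (𝓝 0))
    {c : ℕ → (Fin n → ℝ) → ℝ} (hc : ∀ i, AnalyticAt ℝ (c i) 0) (hc0 : ∀ i < m, c i 0 = 0)
    {u : (Fin n → ℝ) × ℝ → ℝ} (hu : AnalyticAt ℝ u 0) (hu0 : u 0 ≠ 0) :
    RegularlyUniformizes U x fun w =>
      ∑ i ∈ Finset.range m, c i (Fin.tail w) * w 0 ^ i + w 0 ^ (m + 1) * u (Fin.tail w, w 0) := by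
  classical
  set s := (Finset.range m).filter fun i => ¬ ∀ᶠ w in 𝓝 0, c i w = 0 with hs
  have hsm : ∀ i ∈ s, i < m := fun i hi => Finset.mem_range.1 (Finset.mem_filter.1 hi).1
  have hns : ∀ i ∈ Finset.range m, i ∉ s → ∀ᶠ w in 𝓝 0, c i w = 0 := fun i hi his => by
    simpa [hs, Finset.mem_range.1 hi] using his
  have htail : Tendsto (fun w : Fin (n + 1) → ℝ => Fin.tail w) (𝓝 0) (𝓝 0) :=
    tendsto_finTail tendsto_id
  rcases s.eq_empty_or_nonempty with he | hne
  · have hua : AnalyticAt ℝ (fun w : Fin (n + 1) → ℝ => u (Fin.tail w, w 0)) 0 :=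
      hu.comp_of_eq ((analyticAt_finTail 0).prod (analyticAt_pi_apply 0 0)) rfl
    refine ⟨x, id, .refl hx, ⟨_, (((isNormalCrossing_apply 0).pow (m + 1)).mul
      (isNormalCrossing_of_ne_zero hua hu0)).congr ?_⟩, fun j => ⟨_, isNormalCrossing_apply j.succ⟩⟩
    have h0 : ∀ᶠ w in 𝓝 (0 : Fin (n + 1) → ℝ), ∀ i ∈ Finset.range m, c i (Fin.tail w) = 0 :=
      (Filter.eventually_all_finset _).2 fun i hi =>
        htail.eventually (hns i hi (he ▸ Finset.notMem_empty i))
    filter_upwards [h0] with w hw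
    simp only [Function.comp, id]
    rw [Finset.sum_eq_zero fun i hi => by rw [hw i hi, zero_mul], zero_add]
  obtain ⟨y, π, h1, hα⟩ := hU.finset (tendsto_finTail hx) (s.disjSum (Finset.univ : Finset (Fin n)))
    (Sum.elim c fun j w => w j)
    (by
      rintro (i | j) -
      · exact hc i
      · exact analyticAt_pi_apply j 0)
    (by
      rintro (i | j) hi
      · exact (Finset.mem_filter.1 (Finset.inl_mem_disjSum.1 hi)).2
      · exact not_eventually_apply_eq_zero j)
  have hcoord : ∀ j, ∃ α, IsNormalCrossing (fun w => π w j) α := fun j =>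
    hα (Sum.inr j) (by simp)
  have hcα : ∀ i ∈ s, ∃ α, IsNormalCrossing (c i ∘ π) α := fun i hi =>
    hα (Sum.inl i) (by simpa using hi)
  choose! γ hγ using hcα
  obtain ⟨z, ρ, A, h2, α, b, hb, ⟨k, hk, hbk⟩, hbe⟩ := exists_monomialChart_weighted h1.tendsto hne
    (fun i hi => (hsm i hi).trans (Nat.lt_succ_self m)) hγ
  have h3 := h1.trans h2.toAnalyticChart
  have hα0 : α ≠ 0 := by
    rintro rfl
    have := (hbe k hk).self_of_nhds
    simp only [h2.map_zero, Function.comp, h1.map_zero, hc0 k (hsm k hk)] at this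
    exact hbk (by simpa using this.symm)
  set b' : ℕ → (Fin n → ℝ) → ℝ := fun i => if i ∈ s then b i else 0 with hb'
  have hb'a : ∀ i, AnalyticAt ℝ (b' i) 0 := fun i => by
    simp only [hb']
    split_ifs with hi
    · exact hb i hi
    · exact analyticAt_const
  have hb'e : ∀ i ∈ Finset.range m, ∀ᶠ w in 𝓝 0,
      c i (π (ρ w)) = (∏ j, w j ^ α j) ^ (m + 1 - i) * b' i w := fun i hi => by
    by_cases his : i ∈ s
    · simp only [hb', if_pos his]
      exact hbe i his
    · simp only [hb', if_neg his, Pi.zero_apply, mul_zero]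
      exact h3.tendsto_map.eventually (hns i hi his)
  have hchart := h3.cons hx
  have hu' : AnalyticAt ℝ (fun p : (Fin n → ℝ) × ℝ => u (π (ρ p.1), p.2)) 0 :=
    hu.comp_of_eq ((h3.analyticAt.comp_of_eq analyticAt_fst rfl).prod analyticAt_snd)
      (Prod.ext h3.map_zero rfl)
  have hu'0 : u (π (ρ 0), 0) ≠ 0 := by
    rw [h2.map_zero, h1.map_zero]; exact hu0
  have hmain : RegularlyUniformizes U (fun a => Fin.cons (x a 0) (z a)) fun w =>
      ∑ i ∈ Finset.range m, ((∏ j, Fin.tail w j ^ α j) ^ (m + 1 - i) * b' i (Fin.tail w)) * w 0 ^ i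
        + w 0 ^ (m + 1) * u (π (ρ (Fin.tail w)), w 0) := by
    by_cases hC : ∃ C, ∀ᶠ a in (U : Filter X), |(Fin.cons (x a 0) (z a) : Fin (n + 1) → ℝ) 0| ≤
        C * |∏ j : Fin n, (Fin.cons (x a 0) (z a) : Fin (n + 1) → ℝ) j.succ ^ α j|
    · obtain ⟨C, hC⟩ := hC
      exact regularlyUniformizes_of_bounded ih hchart.tendsto hα0 hb'a
        ⟨k, hsm k hk, by simpa only [hb', if_pos hk] using hbk⟩ hu' hu'0 hC
    · exact regularlyUniformizes_of_unbounded hchart.tendsto hb'a hu' hu'0 hC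
  refine .of_chart hchart (fun j => ?_) (γ := 0) (m := fun _ => 1) ?_ ?_ hmain
  · obtain ⟨β, hβ⟩ := hcoord j
    exact ⟨_, (hβ.comp h2).comp_tail⟩
  · exact (isNormalCrossing_of_ne_zero (ι := Fin n) (u := fun _ => 1) analyticAt_const
      one_ne_zero).comp_tail
  · have h0 : ∀ᶠ w in 𝓝 (0 : Fin (n + 1) → ℝ), ∀ i ∈ Finset.range m, c i (π (ρ (Fin.tail w)))
        = (∏ j, Fin.tail w j ^ α j) ^ (m + 1 - i) * b' i (Fin.tail w) :=
      (Filter.eventually_all_finset _).2 fun i hi => htail.eventually (hb'e i hi)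
    filter_upwards [h0] with w hw
    simp only [Fin.tail_cons, Fin.cons_zero, Function.comp, one_mul]
    congr 1
    exact Finset.sum_congr rfl fun i hi => by rw [hw i hi]

theorem UniformizesAlong.uniformizesRegular (hU : UniformizesAlong U n) (d : ℕ) :
    UniformizesRegular U n d := by
  induction d using Nat.strong_induction_on with
  | _ d ih =>
    intro x g v hx hg hv hv0 hgv
    cases d with
    | zero =>
      have hg0 : g 0 ≠ 0 := by
        have := hgv.self_of_nhds
        rw [finCons_zero] at this
        simpa [this] using hv0
      exact ⟨x, id, .refl hx, ⟨0, isNormalCrossing_of_ne_zero hg hg0⟩,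
        fun j => ⟨_, isNormalCrossing_apply j.succ⟩⟩
    | succ m =>
      have hcons : AnalyticAt ℝ (fun p : (Fin n → ℝ) × ℝ => (Fin.cons p.2 p.1 : Fin (n + 1) → ℝ))
          0 := analyticAt_snd.finCons analyticAt_fst
      obtain ⟨φ, c, u, hφ, hφ0, hc, hc0, hu, hu0, he⟩ :=
        (hg.comp_of_eq hcons finCons_zero).exists_tschirnhaus m hv hv0 hgv
      have hφt : AnalyticAt ℝ (fun w : Fin (n + 1) → ℝ => φ (Fin.tail w)) 0 :=
        hφ.comp_of_eq (analyticAt_finTail 0) rfl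
      have hφt0 : φ (Fin.tail (0 : Fin (n + 1) → ℝ)) = 0 := hφ0
      have hchart : AnalyticChart U x
          (fun a => Fin.cons (x a 0 - φ (Fin.tail (x a))) (Fin.tail (x a)))
          (fun w => Fin.cons (w 0 + φ (Fin.tail w)) (Fin.tail w)) := by
        refine ⟨tendsto_finCons ?_ (tendsto_finTail hx),
          ((analyticAt_pi_apply 0 0).add hφt).finCons (analyticAt_finTail 0), ?_, ?_⟩
        · have h := hφ.continuousAt.tendsto.comp (tendsto_finTail hx)
          simpa [hφ0] using (tendsto_pi_nhds.1 hx 0).sub h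
        · rw [hφt0, Pi.zero_apply, add_zero]; exact finCons_zero
        · refine Eventually.of_forall fun a => ?_
          simp only [Fin.tail_cons, Fin.cons_zero, sub_add_cancel, Fin.cons_self_tail]
      refine .of_chart hchart (fun j => ⟨_, (isNormalCrossing_apply j).comp_tail⟩) (γ := 0)
        (m := fun _ => 1) ?_ ?_
        (regularlyUniformizes_of_tschirnhaus hU ih hchart.tendsto hc hc0 hu hu0)
      · exact (isNormalCrossing_of_ne_zero (ι := Fin n) (u := fun _ => 1) analyticAt_const
          one_ne_zero).comp_tail
      · have ht : Tendsto (fun w : Fin (n + 1) → ℝ => (Fin.tail w, w 0)) (𝓝 0) (𝓝 (0, 0)) :=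
          (tendsto_finTail tendsto_id).prodMk_nhds (tendsto_pi_nhds.1 tendsto_id 0)
        filter_upwards [ht.eventually he] with w hw
        rw [one_mul]
        exact hw

/-- Some line through the origin on which an analytic function has finite order. -/
lemma AnalyticAt.exists_line_order {E : Type*} [NormedAddCommGroup E] [NormedSpace ℝ E]
    {f : E → ℝ} (hf : AnalyticAt ℝ f 0) (hf0 : f 0 = 0) (h : ¬ ∀ᶠ w in 𝓝 0, f w = 0) :
    ∃ w ≠ (0 : E), ∃ (d : ℕ) (v : ℝ → ℝ), AnalyticAt ℝ v 0 ∧ v 0 ≠ 0 ∧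
      ∀ᶠ t in 𝓝 (0 : ℝ), f (t • w) = t ^ d * v t := by
  obtain ⟨r, hr, hb⟩ := Metric.eventually_nhds_iff_ball.1 hf.eventually_analyticAt
  obtain ⟨w, hfw, hw⟩ := ((not_eventually.1 h).and_eventually
    (Metric.ball_mem_nhds (0 : E) hr)).exists
  refine ⟨w, fun hw0 => hfw (hw0 ▸ hf0), ?_⟩
  set L : ℝ →L[ℝ] E := ContinuousLinearMap.toSpanSingleton ℝ w
  have hL : ∀ t, L t = t • w := fun t => rfl
  set S : Set ℝ := L ⁻¹' Metric.ball 0 r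
  have hS : IsPreconnected S := ((convex_ball (0 : E) r).linear_preimage L.toLinearMap).isPreconnected
  have h0S : (0 : ℝ) ∈ S := by simp [S, hr]
  have h1S : (1 : ℝ) ∈ S := by
    change L 1 ∈ Metric.ball 0 r
    rwa [hL, one_smul]
  have hga : AnalyticOnNhd ℝ (f ∘ L) S := fun t ht => (hb (L t) ht).comp (L.analyticAt t)
  have hg0 : ¬ ∀ᶠ t in 𝓝 0, (f ∘ L) t = 0 := fun h0 => by
    have := hga.eqOn_zero_of_preconnected_of_eventuallyEq_zero hS h0S h0 h1S
    simp only [Function.comp, hL, one_smul] at this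
    exact hfw this
  obtain ⟨d, v, hv, hv0, he⟩ := (hga 0 h0S).exists_eventuallyEq_pow_smul_nonzero_iff.2 hg0
  refine ⟨d, v, hv, hv0, he.mono fun t ht => ?_⟩
  simpa [hL] using ht

/-- Local uniformization of real analytic functions along ultrafilters. -/
theorem uniformizesAlong (U : Ultrafilter X) (n : ℕ) : UniformizesAlong U n := by
  induction n with
  | zero =>
    intro x f hx hf hf0
    refine ⟨x, id, 0, .refl hx, isNormalCrossing_of_ne_zero hf fun h0 => hf0 ?_⟩
    exact Eventually.of_forall fun w => by rw [Subsingleton.elim w 0]; exact h0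
  | succ n ih =>
    intro x f hx hf hfz
    by_cases hf0 : f 0 = 0
    swap
    · exact ⟨x, id, 0, .refl hx, isNormalCrossing_of_ne_zero hf hf0⟩
    obtain ⟨w, hw, d, v, hv, hv0, he⟩ := hf.exists_line_order hf0 hfz
    obtain ⟨L, hL⟩ := SeparatingDual.exists_continuousLinearEquiv_apply_eq (R := ℝ)
      (x := (Fin.cons 1 0 : Fin (n + 1) → ℝ)) (y := w)
      (fun h => one_ne_zero (congrFun h 0)) hw
    have hLa : ∀ p, AnalyticAt ℝ L p := fun p =>
      (L : (Fin (n + 1) → ℝ) →L[ℝ] Fin (n + 1) → ℝ).analyticAt p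
    have hLc : ∀ z : ℝ, L (Fin.cons z 0) = z • w := fun z => by
      rw [← hL, ← map_smul]
      congr 1
      ext j
      cases j using Fin.cases <;> simp
    obtain ⟨y, π, hc, ⟨α, hα⟩, -⟩ := ih.uniformizesRegular d (fun a => L.symm (x a)) (f ∘ L) v
      (by simpa [Function.comp_def] using (L.symm.continuous.tendsto 0).comp hx)
      (hf.comp_of_eq (hLa 0) (map_zero L)) hv hv0
      (he.mono fun z hz => by rw [Function.comp, hLc, hz])
    refine ⟨y, L ∘ π, α, ⟨hc.tendsto, (hLa _).comp_of_eq hc.analyticAt rfl, ?_, ?_⟩, hα⟩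
    · simp [hc.map_zero]
    · filter_upwards [hc.eventuallyEq] with a ha
      rw [Function.comp, ← ha, L.apply_symm_apply]

end LocalUniformization

section Gradient

lemma le_of_le_mul_rpow {a b D : ℝ} {t : ℝ} (ha : 0 ≤ a) (hb : 0 ≤ b) (hD : 0 ≤ D)
    (ht1 : t < 1) (h : a ≤ D * a ^ t * b) : a ^ (1 - t) ≤ D * b := by
  rcases ha.eq_or_lt with rfl | ha
  · rw [Real.zero_rpow (by linarith)]
    positivity
  · rw [Real.rpow_sub ha, Real.rpow_one, div_le_iff₀ (Real.rpow_pos_of_pos ha t)]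
    linarith

/-- The logarithmic derivative estimate for normal crossings. -/
lemma IsNormalCrossing.exists_abs_le_mul_norm_fderiv {ι : Type*} [Fintype ι]
    {f : (ι → ℝ) → ℝ} {α : ι → ℕ} (hf : IsNormalCrossing f α) :
    ∃ C > 0, ∀ᶠ w in 𝓝 0, ∀ i, α i ≠ 0 → |f w| ≤ C * |w i| * ‖fderiv ℝ f w‖ := by
  classical
  obtain ⟨u, hu, hu0, hue⟩ := id hf
  set κ := |u 0| with hκ
  have hκ0 : 0 < κ := abs_pos.2 hu0
  set B := ‖fderiv ℝ u 0‖ + 1 with hB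
  have hB0 : 0 < B := by positivity
  have h1 : ∀ᶠ w in 𝓝 0, κ / 2 < |u w| :=
    continuousAt_const.eventually_lt hu.continuousAt.abs (half_lt_self hκ0)
  have h2 : ∀ᶠ w in 𝓝 0, |u w| < 2 * κ :=
    hu.continuousAt.abs.eventually_lt continuousAt_const (by linarith)
  have h3 : ∀ᶠ w in 𝓝 0, ‖fderiv ℝ u w‖ < B :=
    hu.fderiv.continuousAt.norm.eventually_lt continuousAt_const (by simp [hB])
  have h4 : ∀ᶠ w : ι → ℝ in 𝓝 0, ‖w‖ < κ / (4 * B) :=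
    continuous_norm.continuousAt.eventually_lt continuousAt_const (by simp; positivity)
  refine ⟨8, by norm_num, ?_⟩
  filter_upwards [h1, h2, h3, h4, hue.eventually_nhds, hue, hu.eventually_analyticAt,
    hf.analyticAt.eventually_analyticAt] with w h1 h2 h3 h4 h5 h6 h7 h8 i hi
  set e : ι → ℝ := Pi.single i (w i) with he
  set M := ∏ j, w j ^ α j with hM
  have hline : HasDerivAt (fun t : ℝ => w + t • e) e 0 := by
    simpa using ((hasDerivAt_id (0 : ℝ)).smul_const e).const_add w
  have hline0 : w + (0 : ℝ) • e = w := by simp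
  have hd1 : HasDerivAt (fun t : ℝ => f (w + t • e)) (fderiv ℝ f w e) 0 :=
    HasFDerivAt.comp_hasDerivAt (f := fun t : ℝ => w + t • e) 0
      (by rw [hline0]; exact h8.differentiableAt.hasFDerivAt) hline
  have hd2 : HasDerivAt (fun t : ℝ => u (w + t • e)) (fderiv ℝ u w e) 0 :=
    HasFDerivAt.comp_hasDerivAt (f := fun t : ℝ => w + t • e) 0
      (by rw [hline0]; exact h7.differentiableAt.hasFDerivAt) hline
  have hmon : ∀ t : ℝ, ∏ j, (w + t • e) j ^ α j = (1 + t) ^ α i * M := fun t => by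
    rw [hM, ← Finset.mul_prod_erase _ _ (Finset.mem_univ i),
      ← Finset.mul_prod_erase _ (fun j => w j ^ α j) (Finset.mem_univ i), ← mul_assoc, ← mul_pow]
    congr 1
    · simp [he]; ring
    · refine Finset.prod_congr rfl fun j hj => ?_
      simp [he, Finset.ne_of_mem_erase hj]
  have hd3 : HasDerivAt (fun t : ℝ => (1 + t) ^ α i * M * u (w + t • e))
      (α i * M * u w + M * fderiv ℝ u w e) 0 := by
    have h := (((hasDerivAt_id (0 : ℝ)).const_add 1).fun_pow (α i)).mul_const M |>.mul hd2
    exact h.congr_deriv (by simp)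
  have heq : (fun t : ℝ => f (w + t • e)) =ᶠ[𝓝 0] fun t => (1 + t) ^ α i * M * u (w + t • e) := by
    have ht : Tendsto (fun t : ℝ => w + t • e) (𝓝 0) (𝓝 w) := by
      simpa only [hline0] using hline.continuousAt.tendsto
    filter_upwards [ht.eventually h5] with t ht
    rw [ht, hmon]
  have hkey : fderiv ℝ f w e = M * (α i * u w + fderiv ℝ u w e) := by
    rw [hd1.unique (hd3.congr_of_eventuallyEq heq)]
    ring
  have hen : ‖e‖ = |w i| := by rw [he, Pi.norm_single, Real.norm_eq_abs]
  have hwi : |w i| ≤ ‖w‖ := norm_le_pi_norm w i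
  have hsmall : |fderiv ℝ u w e| ≤ κ / 4 := by
    have : |fderiv ℝ u w e| ≤ B * (κ / (4 * B)) :=
      ((fderiv ℝ u w).le_opNorm e).trans (by
        rw [hen]
        exact mul_le_mul h3.le (hwi.trans h4.le) (abs_nonneg _) hB0.le)
    calc _ ≤ _ := this
      _ = κ / 4 := by field_simp
  have hlow : κ / 4 ≤ |α i * u w + fderiv ℝ u w e| := by
    have hα1 : (1 : ℝ) ≤ α i := by exact_mod_cast Nat.one_le_iff_ne_zero.2 hi
    have h9 : |α i * u w| - |fderiv ℝ u w e| ≤ |α i * u w + fderiv ℝ u w e| := by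
      simpa using abs_sub_abs_le_abs_sub (α i * u w) (-fderiv ℝ u w e)
    have h10 : |u w| ≤ |α i * u w| := by
      rw [abs_mul, Nat.abs_cast]
      exact le_mul_of_one_le_left (abs_nonneg _) hα1
    linarith
  have hup : |M| * (κ / 4) ≤ ‖fderiv ℝ f w‖ * |w i| := by
    calc |M| * (κ / 4) ≤ |M| * |α i * u w + fderiv ℝ u w e| :=
          mul_le_mul_of_nonneg_left hlow (abs_nonneg _)
      _ = |fderiv ℝ f w e| := by rw [hkey, abs_mul]
      _ ≤ ‖fderiv ℝ f w‖ * |w i| := hen ▸ (fderiv ℝ f w).le_opNorm e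
  rw [h6, abs_mul]
  calc |M| * |u w| ≤ |M| * (2 * κ) := mul_le_mul_of_nonneg_left h2.le (abs_nonneg _)
    _ = 8 * (|M| * (κ / 4)) := by ring
    _ ≤ 8 * (‖fderiv ℝ f w‖ * |w i|) := by gcongr
    _ = _ := by ring

/-- The Łojasiewicz gradient inequality for normal crossings. -/
theorem IsNormalCrossing.exists_lojasiewicz {ι : Type*} [Fintype ι]
    {f : (ι → ℝ) → ℝ} {α : ι → ℕ} (hf : IsNormalCrossing f α) (hα : α ≠ 0) :
    ∃ N : ℕ, 2 ≤ N ∧ ∃ C > 0, ∀ᶠ w in 𝓝 0,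
      |f w| ^ (1 - (N : ℝ)⁻¹) ≤ C * ‖fderiv ℝ f w‖ := by
  obtain ⟨C, hC, hle⟩ := hf.exists_abs_le_mul_norm_fderiv
  obtain ⟨u, hu, hu0, hue⟩ := id hf
  set κ := |u 0| / 2 with hκ
  have hκ0 : 0 < κ := half_pos (abs_pos.2 hu0)
  set s := Finset.univ.filter fun i => α i ≠ 0 with hs
  have hsne : s.Nonempty := by
    obtain ⟨i, hi⟩ := Function.ne_iff.1 hα
    exact ⟨i, by simpa [hs] using hi⟩
  set N := ∑ i, α i + 1 with hN
  have hN2 : 2 ≤ N := by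
    obtain ⟨i, hi⟩ := Function.ne_iff.1 hα
    have h1 := Finset.single_le_sum (fun j _ => Nat.zero_le (α j)) (Finset.mem_univ i)
    have h2 := Nat.one_le_iff_ne_zero.2 hi
    omega
  have hN0 : N ≠ 0 := by omega
  refine ⟨N, hN2, C * (κ⁻¹) ^ (N : ℝ)⁻¹, by positivity, ?_⟩
  have h1 : ∀ᶠ w in 𝓝 0, κ < |u w| :=
    continuousAt_const.eventually_lt hu.continuousAt.abs (half_lt_self (abs_pos.2 hu0))
  have h4 : ∀ᶠ w : ι → ℝ in 𝓝 0, ‖w‖ < 1 :=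
    continuous_norm.continuousAt.eventually_lt continuousAt_const (by simp)
  filter_upwards [hle, h1, h4, hue] with w h2 h3 h4 h5
  obtain ⟨i, his, himin⟩ := s.exists_min_image (fun i => |w i|) hsne
  have hi : α i ≠ 0 := (Finset.mem_filter.1 his).2
  have hwi1 : |w i| ≤ 1 := (norm_le_pi_norm w i).trans h4.le
  have hpow : |w i| ^ N ≤ |f w| * κ⁻¹ := by
    have hM : |w i| ^ (∑ j, α j) ≤ |∏ j, w j ^ α j| := by
      rw [Finset.abs_prod, ← Finset.prod_pow_eq_pow_sum]
      refine Finset.prod_le_prod (fun j _ => by positivity) fun j _ => ?_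
      rw [abs_pow]
      by_cases hj : α j = 0
      · simp [hj]
      · exact pow_le_pow_left₀ (abs_nonneg _) (himin j (by simp [hs, hj])) _
    rw [← div_eq_mul_inv, le_div_iff₀ hκ0, h5, abs_mul]
    refine mul_le_mul ?_ h3.le hκ0.le (abs_nonneg _)
    exact (pow_le_pow_of_le_one (abs_nonneg _) hwi1 (Nat.le_succ _)).trans hM
  have hroot : |w i| ≤ |f w| ^ (N : ℝ)⁻¹ * (κ⁻¹) ^ (N : ℝ)⁻¹ := by
    rw [← Real.mul_rpow (abs_nonneg _) (by positivity)]
    calc |w i| = (|w i| ^ N) ^ (N : ℝ)⁻¹ := (Real.pow_rpow_inv_natCast (abs_nonneg _) hN0).symm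
      _ ≤ _ := Real.rpow_le_rpow (by positivity) hpow (by positivity)
  refine le_of_le_mul_rpow (abs_nonneg _) (norm_nonneg _) (by positivity)
    (inv_lt_one_of_one_lt₀ (by exact_mod_cast hN2)) ((h2 i hi).trans ?_)
  calc C * |w i| * ‖fderiv ℝ f w‖
      ≤ C * (|f w| ^ (N : ℝ)⁻¹ * (κ⁻¹) ^ (N : ℝ)⁻¹) * ‖fderiv ℝ f w‖ := by gcongr
    _ = _ := by ring

lemma AnalyticAt.exists_norm_fderiv_comp_le {E F G : Type*} [NormedAddCommGroup E]
    [NormedSpace ℝ E] [NormedAddCommGroup F] [NormedSpace ℝ F] [CompleteSpace F]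
    [NormedAddCommGroup G] [NormedSpace ℝ G] [CompleteSpace G] {g : F → G} {π : E → F} {x : E}
    (hg : AnalyticAt ℝ g (π x)) (hπ : AnalyticAt ℝ π x) :
    ∃ K > 0, ∀ᶠ w in 𝓝 x, ‖fderiv ℝ (g ∘ π) w‖ ≤ K * ‖fderiv ℝ g (π w)‖ := by
  refine ⟨‖fderiv ℝ π x‖ + 1, by positivity, ?_⟩
  have h3 : ∀ᶠ w in 𝓝 x, ‖fderiv ℝ π w‖ < ‖fderiv ℝ π x‖ + 1 :=
    hπ.fderiv.continuousAt.norm.eventually_lt continuousAt_const (by simp)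
  filter_upwards [h3, hπ.eventually_analyticAt,
    hπ.continuousAt.tendsto.eventually hg.eventually_analyticAt] with w h1 h2 h3
  rw [fderiv_comp w h3.differentiableAt h2.differentiableAt, mul_comm]
  exact (ContinuousLinearMap.opNorm_comp_le _ _).trans
    (mul_le_mul_of_nonneg_left h1.le (norm_nonneg _))

/-- The Łojasiewicz gradient inequality along an ultrafilter. -/
lemma exists_lojasiewicz_ultrafilter {X : Type*} (U : Ultrafilter X) {n : ℕ}
    {x : X → Fin n → ℝ} (hx : Tendsto x U (𝓝 0)) {f : (Fin n → ℝ) → ℝ} (hf : AnalyticAt ℝ f 0)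
    (hf0 : f 0 = 0) (hfz : ¬ ∀ᶠ w in 𝓝 0, f w = 0) :
    ∃ N : ℕ, 2 ≤ N ∧ ∃ C > 0, ∀ᶠ a in (U : Filter X),
      |f (x a)| ^ (1 - (N : ℝ)⁻¹) ≤ C * ‖fderiv ℝ f (x a)‖ := by
  obtain ⟨y, π, α, hc, hα⟩ := uniformizesAlong U n x f hx hf hfz
  have hα0 : α ≠ 0 := hα.apply_zero.1 (by rw [Function.comp, hc.map_zero, hf0])
  obtain ⟨N, hN, C, hC, h⟩ := hα.exists_lojasiewicz hα0
  obtain ⟨K, hK, h'⟩ := AnalyticAt.exists_norm_fderiv_comp_le (g := f) (π := π) (x := 0)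
    (by rwa [hc.map_zero]) hc.analyticAt
  refine ⟨N, hN, C * K, by positivity, ?_⟩
  filter_upwards [hc.tendsto.eventually h, hc.tendsto.eventually h', hc.eventuallyEq]
    with a h1 h2 h3
  rw [h3, mul_assoc]
  exact h1.trans (mul_le_mul_of_nonneg_left h2 hC.le)

/-- The Łojasiewicz gradient inequality for real analytic functions. -/
theorem AnalyticAt.exists_lojasiewicz {n : ℕ} {f : (Fin n → ℝ) → ℝ} (hf : AnalyticAt ℝ f 0)
    (hf0 : f 0 = 0) :
    ∃ θ ∈ Ioc (0 : ℝ) (1 / 2), ∃ C > (0 : ℝ), ∀ᶠ x in 𝓝 0,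
      |f x| ^ (1 - θ) ≤ C * ‖fderiv ℝ f x‖ := by
  by_cases hfz : ∀ᶠ w in 𝓝 0, f w = 0
  · refine ⟨1 / 2, by norm_num, 1, one_pos, hfz.mono fun x hx => ?_⟩
    rw [hx, abs_zero, Real.zero_rpow (by norm_num)]
    positivity
  by_contra! hcon
  have hk : ∀ k : ℕ, ∃ x : Fin n → ℝ, ‖x‖ < 1 / ((k : ℝ) + 1) ∧
      ((k : ℝ) + 2) * ‖fderiv ℝ f x‖ < |f x| ^ (1 - ((k : ℝ) + 2)⁻¹) := fun k => by
    have hθ : ((k : ℝ) + 2)⁻¹ ∈ Ioc (0 : ℝ) (1 / 2) :=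
      ⟨by positivity, by
        rw [one_div]
        exact inv_anti₀ two_pos (by linarith [Nat.cast_nonneg (α := ℝ) k])⟩
    have hball : ∀ᶠ x : Fin n → ℝ in 𝓝 0, ‖x‖ < 1 / ((k : ℝ) + 1) :=
      continuous_norm.continuousAt.eventually_lt continuousAt_const (by simp; positivity)
    obtain ⟨x, h1, h2⟩ := ((hcon _ hθ ((k : ℝ) + 2) (by positivity)).and_eventually hball).exists
    exact ⟨x, h2, h1⟩
  choose x hx hxf using hk
  have hxt : Tendsto x atTop (𝓝 0) :=
    squeeze_zero_norm (fun k => (hx k).le) tendsto_one_div_add_atTop_nhds_zero_nat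
  have hxU : Tendsto x (hyperfilter ℕ) (𝓝 0) := hxt.mono_left Nat.hyperfilter_le_atTop
  obtain ⟨N, hN, C, hC, h⟩ := exists_lojasiewicz_ultrafilter (hyperfilter ℕ) hxU hf hf0 hfz
  have hf1 : ∀ᶠ w in 𝓝 0, |f w| < 1 :=
    hf.continuousAt.abs.eventually_lt continuousAt_const (by simp [hf0])
  have hbig : ∀ᶠ k : ℕ in hyperfilter ℕ, max N ⌈C⌉₊ ≤ k :=
    Nat.hyperfilter_le_atTop (eventually_ge_atTop _)
  obtain ⟨k, h1, h2, h3⟩ := (h.and ((hxU.eventually hf1).and hbig)).exists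
  have hkN : (N : ℝ) ≤ (k : ℝ) + 2 := by
    have : (N : ℝ) ≤ k := by exact_mod_cast (le_max_left _ _).trans h3
    linarith
  have hkC : C ≤ (k : ℝ) + 2 := by
    have : (⌈C⌉₊ : ℝ) ≤ k := by exact_mod_cast (le_max_right _ _).trans h3
    linarith [Nat.le_ceil C]
  have hN0 : (0 : ℝ) < N := by exact_mod_cast (by omega : 0 < N)
  refine absurd (hxf k) (not_lt.2 ?_)
  calc |f (x k)| ^ (1 - ((k : ℝ) + 2)⁻¹) ≤ |f (x k)| ^ (1 - (N : ℝ)⁻¹) := by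
        refine Real.rpow_le_rpow_of_exponent_ge' (abs_nonneg _) h2.le ?_ ?_
        · have : (N : ℝ)⁻¹ ≤ 1 := inv_le_one_of_one_le₀ (by exact_mod_cast (by omega : 1 ≤ N))
          linarith
        · have := inv_anti₀ hN0 hkN
          linarith
    _ ≤ C * ‖fderiv ℝ f (x k)‖ := h1
    _ ≤ ((k : ℝ) + 2) * ‖fderiv ℝ f (x k)‖ := by gcongr

end Gradient

end Helpers

/-- Lemma 2.7 (abstract form): Łojasiewicz inequality along an analytic parametrization.
If `ψ : ℝⁿ → V` is analytic near `0` and `E : V → ℝ` is analytic near `ψ 0` with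
`∇E (ψ 0) = 0`, then there exist `θ ∈ (0, 1/2]`, `C > 0` and `r > 0` such that
`|E (ψ x) - E (ψ 0)| ^ (1 - θ) ≤ C * ‖∇E (ψ x)‖` for all `‖x‖ < r`. -/
theorem lojasiewicz_along_analytic_parametrization
    {V : Type*} [NormedAddCommGroup V] [InnerProductSpace ℝ V] [CompleteSpace V]
    (n : ℕ) (hn : 1 ≤ n) (ψ : EuclideanSpace ℝ (Fin n) → V)
    (s : Set (EuclideanSpace ℝ (Fin n))) (hs : IsOpen s) (h0s : (0 : EuclideanSpace ℝ (Fin n)) ∈ s)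
    (hψ : AnalyticOnNhd ℝ ψ s)
    (E : V → ℝ) (u : Set V) (hu : IsOpen u) (hψ0u : ψ 0 ∈ u)
    (hE : AnalyticOnNhd ℝ E u)
    (hgrad0 : gradient E (ψ 0) = 0) :
    ∃ θ ∈ Ioc (0 : ℝ) (1 / 2), ∃ C > (0 : ℝ), ∃ r > (0 : ℝ),
      ∀ x : EuclideanSpace ℝ (Fin n), ‖x‖ < r →
        |E (ψ x) - E (ψ 0)| ^ (1 - θ) ≤ C * ‖gradient E (ψ x)‖ := by
  set T := EuclideanSpace.equiv (Fin n) ℝ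
  set φ : (Fin n → ℝ) → V := fun w => ψ (T.symm w) with hφdef
  have hφ0 : φ 0 = ψ 0 := by rw [hφdef]; simp only [map_zero]
  have hφ : AnalyticAt ℝ φ 0 :=
    (hψ 0 h0s).comp_of_eq
      ((T.symm : (Fin n → ℝ) →L[ℝ] EuclideanSpace ℝ (Fin n)).analyticAt 0) (map_zero T.symm)
  have hEφ : AnalyticAt ℝ E (φ 0) := hφ0 ▸ hE _ hψ0u
  obtain ⟨θ, hθ, C, hC, h⟩ := ((hEφ.comp hφ).sub (analyticAt_const (v := E (ψ 0)))).exists_lojasiewicz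
    (by simp [hφ0])
  obtain ⟨K, hK, h'⟩ := AnalyticAt.exists_norm_fderiv_comp_le hEφ hφ
  have hT : Filter.Tendsto T (nhds 0) (nhds 0) := by simpa using T.continuous.tendsto 0
  obtain ⟨r, hr, hball⟩ := Metric.eventually_nhds_iff_ball.1 (hT.eventually (h.and h'))
  refine ⟨θ, hθ, C * K, by positivity, r, hr, fun x hx => ?_⟩
  obtain ⟨h1, h2⟩ := hball x (by simpa using hx)
  have hφT : φ (T x) = ψ x := by simp [hφdef]
  have hnorm : ‖gradient E (ψ x)‖ = ‖fderiv ℝ E (ψ x)‖ := by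
    rw [gradient, LinearIsometryEquiv.norm_map]
  have hsub : fderiv ℝ (E ∘ φ - fun _ => E (ψ 0)) (T x) = fderiv ℝ (E ∘ φ) (T x) :=
    fderiv_sub_const _
  rw [hsub, Pi.sub_apply, Function.comp, hφT] at h1
  rw [hφT] at h2
  rw [hnorm, mul_assoc]
  exact h1.trans (mul_le_mul_of_nonneg_left h2 hC.le)
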